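/- Fix integers m ≥ 2, n ≥ 4, and 1 ≤ h ≤ n − 3, and fix real numbers c_{i,σ} for 1 ≤ i ≤ m and σ a permutation of {1, …, n}. There exists a constant C > 0 such that for every finite field F with q elements (where, if m > 2, the characteristic of F is assumed greater than n), the following holds. For each i, let φ_i be the arithmetic function of von Mangoldt type on M_n(F) associated to the coefficients (c_{i,σ})_σ. Then | (1/q^n) · Σ_{f ∈ M_n(F)} ∏_{i=1}^m ( Σ_{g ∈ F[x], deg g ≤ h} φ_i(f + g) ) − ( ∏_{i=1}^m Σ_σ c_{i,σ} ) · q^{(h+1)m} | ≤ C·q^{(h+1)(m−1)}. -/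

import Mathlib

open scoped Classical

/-- The monic polynomial `X ^ n + ∑_{j < n} c j * X ^ j`; as `c` ranges over `Fin n → F`
this enumerates the monic polynomials of degree `n` exactly once. -/
noncomputable def monicOfCoeffs {F : Type*} [Field F] (n : ℕ) (c : Fin n → F) : Polynomial F :=
  Polynomial.X ^ n + ∑ j : Fin n, Polynomial.C (c j) * Polynomial.X ^ (j : ℕ)

/-- The arithmetic function of von Mangoldt type on monic degree-`n` polynomials over the
finite field `F` with `q` elements associated to real coefficients `(c σ)σ`:
`φ f = ∑_{z ∈ K^n, f = ∏ (x - z j)} ∑ σ, c σ • δ_σ z`, where `K` is an algebraic closure of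
`F` and `δ_σ z = 1` if `z j ^ q = z (σ j)` for all `j`, and `0` otherwise. -/
noncomputable def vonMangoldtType (F : Type*) [Field F] [Fintype F] (n : ℕ)
    (c : Equiv.Perm (Fin n) → ℝ) (f : Polynomial F) : ℝ :=
  ∑ᶠ z : Fin n → AlgebraicClosure F,
    if Polynomial.map (algebraMap F (AlgebraicClosure F)) f =
        ∏ j : Fin n, (Polynomial.X - Polynomial.C (z j)) then
      ∑ σ : Equiv.Perm (Fin n), c σ *
        (if ∀ j, z j ^ Fintype.card F = z (σ j) then 1 else 0)
    else 0

/-! ### Weighted filtrations -/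

section WeightedFiltration

variable {K R ι : Type*} [Field K] [CommRing R] [Algebra K R] [Fintype ι]

/-- The monomial `∏ i, x i ^ e i`. -/
def monomialAt (x : ι → R) (e : ι → ℕ) : R := ∏ i, x i ^ e i

/-- The weight `∑ i, e i * w i` of an exponent vector. -/
def weightOf (w : ι → ℕ) (e : ι → ℕ) : ℕ := ∑ i, e i * w i

/-- The span of the monomials of weight `< m`. -/
def weightLT (K : Type*) {R ι : Type*} [Field K] [CommRing R] [Algebra K R] [Fintype ι]
    (x : ι → R) (w : ι → ℕ) (m : ℕ) : Submodule K R :=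
  Submodule.span K {f | ∃ e, weightOf w e < m ∧ monomialAt x e = f}

/-- Two monomials of the same weight agree up to monomials of smaller weight. -/
def WeightsSeparate (K : Type*) {R ι : Type*} [Field K] [CommRing R] [Algebra K R] [Fintype ι]
    (x : ι → R) (w : ι → ℕ) : Prop :=
  ∀ e e' : ι → ℕ, weightOf w e = weightOf w e' →
    monomialAt x e - monomialAt x e' ∈ weightLT K x w (weightOf w e)

/-- `f` is a nonzero multiple of a monomial of weight `m`, up to smaller weight. -/
def HasWeight (K : Type*) {R ι : Type*} [Field K] [CommRing R] [Algebra K R] [Fintype ι]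
    (x : ι → R) (w : ι → ℕ) (f : R) (m : ℕ) : Prop :=
  ∃ (e : ι → ℕ) (c : K), c ≠ 0 ∧ weightOf w e = m ∧ f - c • monomialAt x e ∈ weightLT K x w m

variable {x : ι → R} {w : ι → ℕ}

lemma monomialAt_add (e e' : ι → ℕ) :
    monomialAt x (e + e') = monomialAt x e * monomialAt x e' := by
  simp [monomialAt, pow_add, Finset.prod_mul_distrib]

lemma monomialAt_smul (n : ℕ) (e : ι → ℕ) : monomialAt x (n • e) = monomialAt x e ^ n := by
  simp only [monomialAt, Pi.smul_apply, smul_eq_mul, ← Finset.prod_pow]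
  exact Finset.prod_congr rfl fun i _ => by rw [mul_comm, pow_mul]

lemma weightOf_add (e e' : ι → ℕ) : weightOf w (e + e') = weightOf w e + weightOf w e' := by
  simp [weightOf, add_mul, Finset.sum_add_distrib]

lemma weightOf_smul (n : ℕ) (e : ι → ℕ) : weightOf w (n • e) = n * weightOf w e := by
  simp [weightOf, Finset.mul_sum, mul_assoc]

lemma monomialAt_mem {e : ι → ℕ} {m : ℕ} (h : weightOf w e < m) :
    monomialAt x e ∈ weightLT K x w m :=
  Submodule.subset_span ⟨e, h, rfl⟩

lemma weightLT_mono {m m' : ℕ} (h : m ≤ m') : weightLT K x w m ≤ weightLT K x w m' :=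
  Submodule.span_mono fun _ ⟨e, he, hf⟩ => ⟨e, he.trans_le h, hf⟩

lemma mul_mem_weightLT {f g : R} {a b c : ℕ} (hf : f ∈ weightLT K x w a)
    (hg : g ∈ weightLT K x w b) (h : a + b ≤ c + 1) : f * g ∈ weightLT K x w c := by
  have h1 := Submodule.mul_mem_mul hf hg
  rw [weightLT, weightLT, Submodule.span_mul_span] at h1
  refine Submodule.span_le.2 ?_ h1
  rintro _ ⟨_, ⟨e, he, rfl⟩, _, ⟨e', he', rfl⟩, rfl⟩
  change monomialAt x e * monomialAt x e' ∈ _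
  rw [← monomialAt_add]
  exact monomialAt_mem (by rw [weightOf_add]; omega)

lemma one_mem_weightLT : (1 : R) ∈ weightLT K x w 1 := by
  have := monomialAt_mem (K := K) (x := x) (w := w) (e := 0) (m := 1) (by simp [weightOf])
  simpa [monomialAt] using this

lemma pow_mem_weightLT {f : R} {a : ℕ} (hf : f ∈ weightLT K x w (a + 1)) (n : ℕ) :
    f ^ n ∈ weightLT K x w (n * a + 1) := by
  induction n with
  | zero => simpa using one_mem_weightLT
  | succ n ih => rw [pow_succ]; exact mul_mem_weightLT ih hf (by ring_nf; omega)

lemma monomialAt_mem_of_mem {y : ι → R} (hy : ∀ i, y i ∈ weightLT K x w (w i + 1))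
    (e : ι → ℕ) : monomialAt y e ∈ weightLT K x w (weightOf w e + 1) := by
  unfold monomialAt weightOf
  induction (Finset.univ : Finset ι) using Finset.induction_on with
  | empty => simpa using one_mem_weightLT
  | insert i s hi ih =>
    rw [Finset.prod_insert hi, Finset.sum_insert hi]
    exact mul_mem_weightLT (pow_mem_weightLT (hy i) (e i)) ih (by omega)

lemma monomialAt_single [DecidableEq ι] (i : ι) : monomialAt x (Pi.single i 1) = x i := by
  rw [monomialAt, Finset.prod_eq_single i] <;> simp +contextual

lemma weightOf_single [DecidableEq ι] (i : ι) : weightOf w (Pi.single i 1) = w i := by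
  rw [weightOf, Finset.sum_eq_single i] <;> simp +contextual

lemma coord_mem_weightLT (i : ι) : x i ∈ weightLT K x w (w i + 1) := by
  have := monomialAt_mem (K := K) (x := x) (w := w) (e := Pi.single i 1) (m := w i + 1)
    (by simp [weightOf_single])
  rwa [monomialAt_single] at this

lemma weightLT_succ_le (H : WeightsSeparate K x w) (e : ι → ℕ) :
    weightLT K x w (weightOf w e + 1) ≤
      weightLT K x w (weightOf w e) ⊔ Submodule.span K {monomialAt x e} := by
  refine Submodule.span_le.2 ?_
  rintro _ ⟨e', he', rfl⟩
  rcases Nat.lt_succ_iff_lt_or_eq.1 he' with h | h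
  · exact Submodule.mem_sup_left (monomialAt_mem h)
  · have h1 := H e' e h
    rw [h] at h1
    have := Submodule.add_mem_sup h1
      (Submodule.mem_span_singleton_self (R := K) (monomialAt x e))
    simpa using this

lemma weightLT_zero : weightLT K x w 0 = ⊥ := by
  simp [weightLT]

lemma exists_card_le_weightLT_le (H : WeightsSeparate K x w) (m : ℕ) :
    ∃ s : Finset R, s.card ≤ m ∧ weightLT K x w m ≤ Submodule.span K (s : Set R) := by
  induction m with
  | zero => exact ⟨∅, by simp, by simp [weightLT_zero]⟩
  | succ m ih =>
    obtain ⟨s, hs, h⟩ := ih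
    by_cases hm : ∃ e, weightOf w e = m
    · obtain ⟨e, rfl⟩ := hm
      refine ⟨insert (monomialAt x e) s, (Finset.card_insert_le _ _).trans (by omega), ?_⟩
      refine (weightLT_succ_le H e).trans (sup_le (h.trans ?_) ?_) <;>
        exact Submodule.span_mono (by simp)
    · refine ⟨s, by omega, le_trans (Submodule.span_mono ?_) h⟩
      rintro _ ⟨e, he, rfl⟩
      exact ⟨e, by have : weightOf w e ≠ m := fun h => hm ⟨e, h⟩
                   omega, rfl⟩

lemma hasWeight_sum {J : Type*} (T : Finset J) (e : J → ι → ℕ)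
    (he : Set.InjOn (fun j => weightOf w (e j)) (T : Set J)) (c : J → K)
    (hc : ∃ j ∈ T, c j ≠ 0) :
    ∃ j ∈ T, HasWeight K x w (∑ j ∈ T, c j • monomialAt x (e j)) (weightOf w (e j)) := by
  obtain ⟨j₀, hj₀, hmax⟩ := (T.filter fun j => c j ≠ 0).exists_max_image
    (fun j => weightOf w (e j)) (by obtain ⟨j, hj, h⟩ := hc; exact ⟨j, by simp [hj, h]⟩)
  rw [Finset.mem_filter] at hj₀
  refine ⟨j₀, hj₀.1, e j₀, c j₀, hj₀.2, rfl, ?_⟩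
  rw [← Finset.add_sum_erase T _ hj₀.1, add_sub_cancel_left]
  refine Submodule.sum_mem _ fun j hj => ?_
  rw [Finset.mem_erase] at hj
  by_cases h : c j = 0
  · simp [h]
  · refine Submodule.smul_mem _ _ (monomialAt_mem (lt_of_le_of_ne
      (hmax j (by simp [hj.2, h])) fun h' => hj.1 (he hj.2 hj₀.1 h')))

end WeightedFiltration

section ZeroCount

variable {K Ω ι : Type*} [Field K] [Fintype ι] {x : ι → Ω → K} {w : ι → ℕ}

/-- Multivariate interpolation: on a finite set of points separated by the coordinates,
every function is a combination of monomials. -/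
lemma span_restrict_monomialAt_eq_top (hx : ∀ P Q : Ω, (∀ i, x i P = x i Q) → P = Q)
    (Z : Finset Ω) :
    Submodule.span K (Set.range fun e : ι → ℕ => fun P : Z => monomialAt x e P) = ⊤ := by
  set S := Submodule.span K (Set.range fun e : ι → ℕ => fun P : Z => monomialAt x e P)
  have hone : (1 : Z → K) ∈ S :=
    Submodule.subset_span ⟨0, by ext P; simp [monomialAt]⟩
  have hmul : ∀ f ∈ S, ∀ i, (fun P : Z => x i P * f P) ∈ S := by
    intro f hf i
    induction hf using Submodule.span_induction with
    | mem f hf =>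
      obtain ⟨e, rfl⟩ := hf
      refine Submodule.subset_span ⟨Pi.single i 1 + e, ?_⟩
      ext P
      simp only [monomialAt_add, monomialAt_single, Pi.mul_apply]
    | zero => simpa [Pi.zero_def] using S.zero_mem
    | add f g _ _ hf hg => simpa [mul_add, Pi.add_def] using S.add_mem hf hg
    | smul a f _ hf =>
      convert S.smul_mem a hf using 1
      ext P
      simp only [Pi.smul_apply, smul_eq_mul]
      ring
  have key : ∀ (P : Z) (T : Finset Z), P ∉ T →
      ∃ f ∈ S, f P ≠ 0 ∧ ∀ Q ∈ T, f Q = 0 := by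
    intro P T
    induction T using Finset.induction_on with
    | empty => exact fun _ => ⟨1, hone, by simp, by simp⟩
    | insert Q T hQ ih =>
      intro hP
      rw [Finset.mem_insert, not_or] at hP
      obtain ⟨f, hf, hfP, hfT⟩ := ih hP.2
      obtain ⟨i, hi⟩ : ∃ i, x i P ≠ x i Q := by
        by_contra! h
        exact hP.1 (Subtype.ext (hx _ _ h))
      refine ⟨(fun R : Z => x i R * f R) - x i Q • f, S.sub_mem (hmul f hf i)
        (S.smul_mem _ hf), ?_, ?_⟩
      · simp only [Pi.sub_apply, Pi.smul_apply, smul_eq_mul, ← sub_mul]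
        exact mul_ne_zero (sub_ne_zero.2 hi) hfP
      · intro R hR
        rcases Finset.mem_insert.1 hR with rfl | hR
        · simp
        · simp [hfT R hR]
  rw [eq_top_iff, ← (Pi.basisFun K Z).span_eq, Submodule.span_le]
  rintro _ ⟨P, rfl⟩
  obtain ⟨f, hf, hfP, hfT⟩ := key P (Finset.univ.erase P) (by simp)
  have : (Pi.basisFun K Z P) = (f P)⁻¹ • f := by
    ext Q
    by_cases h : Q = P
    · subst h; simp [hfP]
    · simp [h, hfT Q (by simp [h])]
  rw [this]
  exact S.smul_mem _ hf

/-- A function of weight `m` has at most `m` zeros. -/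
lemma card_zeros_le (H : WeightsSeparate K x w)
    (hx : ∀ P Q : Ω, (∀ i, x i P = x i Q) → P = Q) {f : Ω → K} {m : ℕ}
    (hf : HasWeight K x w f m) (Z : Finset Ω) (hZ : ∀ P ∈ Z, f P = 0) : Z.card ≤ m := by
  obtain ⟨e₀, c, hc, rfl, hf⟩ := hf
  set m := weightOf w e₀
  -- weights that are not `m` plus a weight
  let A : Set ℕ := {γ | (∃ e, weightOf w e = γ) ∧ ¬ ∃ e, γ = m + weightOf w e}
  have hmod : ∀ γ ∈ A, ∀ γ' ∈ A, γ % m = γ' % m → γ ≤ γ' → γ = γ' := by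
    rintro γ ⟨⟨e, rfl⟩, -⟩ γ' ⟨-, h'⟩ hmod hle
    obtain ⟨t, ht⟩ := (Nat.modEq_iff_dvd' hle).1 hmod
    rcases t with _ | t
    · simp at ht; omega
    · exact absurd ⟨e + t • e₀, by
        rw [weightOf_add, weightOf_smul]; change _ = _ + (_ + t * m)
        have : γ' = weightOf w e + m * (t + 1) := by omega
        rw [this]; ring⟩ h'
  have hinj : Set.InjOn (· % m) A := by
    intro γ hγ γ' hγ' h
    rcases le_total γ γ' with h1 | h1
    · exact hmod γ hγ γ' hγ' h h1
    · exact (hmod γ' hγ' γ hγ h.symm h1).symm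
  have hA : ∃ B : Finset ℕ, A = B ∧ B.card ≤ m := by
    rcases Nat.eq_zero_or_pos m with h0 | h0
    · refine ⟨∅, ?_, by simp⟩
      rw [Finset.coe_empty, Set.eq_empty_iff_forall_notMem]
      rintro γ ⟨⟨e, rfl⟩, h⟩
      exact h ⟨e, by omega⟩
    · have hmaps : Set.MapsTo (· % m) A (Finset.range m : Set ℕ) := fun γ _ => by
        simpa using Nat.mod_lt _ h0
      have hfin : A.Finite :=
        Set.Finite.of_finite_image ((Finset.range m).finite_toSet.subset hmaps.image_subset) hinj
      refine ⟨hfin.toFinset, by simp, ?_⟩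
      have := Finset.card_le_card_of_injOn (s := hfin.toFinset) (t := Finset.range m) (· % m)
        (by simpa using hmaps) (by simpa using hinj)
      simpa using this
  obtain ⟨B, hAB, hB⟩ := hA
  have hrep : ∀ γ, ∃ e : ι → ℕ, (∃ e', weightOf w e' = γ) → weightOf w e = γ := fun γ => by
    by_cases h : ∃ e', weightOf w e' = γ
    · exact ⟨h.choose, fun _ => h.choose_spec⟩
    · exact ⟨0, fun h' => absurd h' h⟩
  choose rep hrep using hrep
  let res : (Ω → K) →ₗ[K] (Z → K) := LinearMap.funLeft K K Subtype.val
  let s : Finset (Z → K) := B.image fun γ => res (monomialAt x (rep γ))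
  have hfres : ∀ g : Ω → K, res (g * f) = 0 := fun g => by
    ext P
    simp [res, LinearMap.funLeft, hZ P P.2]
  have hlt : ∀ n, ∀ g ∈ weightLT K x w n, res g ∈ Submodule.span K (s : Set (Z → K)) := by
    intro n
    induction n with
    | zero => intro g hg; rw [weightLT_zero, Submodule.mem_bot] at hg; simp [hg]
    | succ n ih =>
      suffices h : ∀ e, weightOf w e = n →
          res (monomialAt x e) ∈ Submodule.span K (s : Set (Z → K)) by
        intro g hg
        by_cases hn : ∃ e, weightOf w e = n
        · obtain ⟨e, rfl⟩ := hn
          obtain ⟨a, ha, b, hb, rfl⟩ := Submodule.mem_sup.1 (weightLT_succ_le H e hg)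
          obtain ⟨r, rfl⟩ := Submodule.mem_span_singleton.1 hb
          rw [map_add, map_smul]
          exact Submodule.add_mem _ (ih a ha) (Submodule.smul_mem _ _ (h e rfl))
        · refine ih g (Submodule.span_mono ?_ hg)
          rintro _ ⟨e, he, rfl⟩
          exact ⟨e, by have : weightOf w e ≠ n := fun h => hn ⟨e, h⟩
                       omega, rfl⟩
      rintro e rfl
      by_cases hmem : ∃ e', weightOf w e = m + weightOf w e'
      · obtain ⟨e', he'⟩ := hmem
        have h1 : monomialAt x e' * f - c • monomialAt x (e' + e₀) ∈
            weightLT K x w (weightOf w e) := by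
          have := mul_mem_weightLT (monomialAt_mem (K := K) (x := x) (w := w)
            (Nat.lt_succ_self (weightOf w e'))) hf (c := weightOf w e) (by omega)
          rwa [mul_sub, mul_smul_comm, ← monomialAt_add] at this
        have h2 : monomialAt x e - monomialAt x (e' + e₀) ∈ weightLT K x w (weightOf w e) :=
          H _ _ (by rw [weightOf_add, he', add_comm])
        have h3 := Submodule.sub_mem _ (ih _ h2)
          (Submodule.smul_mem _ c⁻¹ (ih _ h1))
        rw [map_sub, map_sub, hfres, map_smul, zero_sub, smul_neg, smul_smul,
          inv_mul_cancel₀ hc, one_smul, sub_neg_eq_add, sub_add_cancel] at h3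
        exact h3
      · have hγ : weightOf w e ∈ A := ⟨⟨e, rfl⟩, hmem⟩
        have h2 := ih _ (H e (rep (weightOf w e)) (hrep _ ⟨e, rfl⟩).symm)
        rw [map_sub] at h2
        have h3 : res (monomialAt x (rep (weightOf w e))) ∈ Submodule.span K (s : Set (Z → K)) :=
          Submodule.subset_span (Finset.mem_coe.2 (Finset.mem_image.2
            ⟨_, by rw [hAB] at hγ; exact hγ, rfl⟩))
        simpa using Submodule.add_mem _ h2 h3
  have htop : (⊤ : Submodule K (Z → K)) ≤ Submodule.span K (s : Set (Z → K)) := by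
    rw [← span_restrict_monomialAt_eq_top hx Z, Submodule.span_le]
    rintro _ ⟨e, rfl⟩
    exact hlt _ _ (monomialAt_mem (Nat.lt_succ_self _))
  calc Z.card = Module.finrank K (Z → K) := by simp
    _ = Module.finrank K (Submodule.span K (s : Set (Z → K))) := by
      rw [top_le_iff.1 htop, finrank_top]
    _ ≤ s.card := finrank_span_finset_le_card s
    _ ≤ B.card := Finset.card_image_le
    _ ≤ m := hB

end ZeroCount

section Stepanov

variable {K Ω ι : Type*} [Field K] [Fintype ι] {x : ι → Ω → K} {w : ι → ℕ}

/-- Stepanov's method, after Bombieri: a bound for the number of points on which the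
`Q ^ 2`-power Frobenius acts as `τ`. -/
theorem card_le_of_frobenius_eq [IsAlgClosed K] (H : WeightsSeparate K x w)
    (hx : ∀ P Q : Ω, (∀ i, x i P = x i Q) → P = Q) (τ : Ω → Ω)
    (hτ : ∀ i, (fun P => x i (τ P)) ∈ weightLT K x w (w i + 1))
    {N Q : ℕ} (hN : ∀ n, N ≤ n → ∃ e, weightOf w e = n) (hQ : N * N + 3 * N + 1 < Q)
    (φ : K →+* K) (hφ : ∀ z, φ z = z ^ Q) (Z : Finset Ω)
    (hZ : ∀ P ∈ Z, ∀ i, x i P ^ (Q * Q) = x i (τ P)) :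
    Z.card ≤ Q * Q + (2 * N + 1) * Q := by
  choose! rep hrep using hN
  let I : Finset (ℕ × ℕ) := Finset.Icc N (Q - 1) ×ˢ Finset.Icc N (Q + 2 * N)
  let y : ι → Ω → K := fun i P => x i (τ P)
  let v : I → Ω → K := fun j =>
    monomialAt x (Q • rep j.1.1) * monomialAt y (rep j.1.2)
  have hI : ∀ j ∈ I, N ≤ j.1 ∧ j.1 ≤ Q - 1 ∧ N ≤ j.2 ∧ j.2 ≤ Q + 2 * N := fun j hj => by
    simp only [I, Finset.mem_product, Finset.mem_Icc] at hj
    tauto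
  have hcard : I.card = (Q - N) * (Q + N + 1) := by
    simp only [I, Finset.card_product, Nat.card_Icc]
    congr 1 <;> omega
  set M := Q * (Q - 1) + (Q + 2 * N) + 1 with hM
  have hMI : M < I.card := by
    rw [hcard, hM]
    obtain ⟨t, rfl⟩ : ∃ t, Q = N + t + 1 := ⟨Q - N - 1, by omega⟩
    have h1 : N + t + 1 - 1 = N + t := rfl
    have h2 : N + t + 1 - N = t + 1 := by omega
    rw [h1, h2]
    nlinarith
  obtain ⟨S, hS, hspan⟩ := exists_card_le_weightLT_le H M
  have hv : ∀ j, v j ∈ weightLT K x w M := fun j => by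
    obtain ⟨h1, h2, h3, h4⟩ := hI j.1 j.2
    refine mul_mem_weightLT (monomialAt_mem (Nat.lt_succ_self _))
      (monomialAt_mem_of_mem hτ (rep j.1.2)) ?_
    rw [weightOf_smul, hrep _ h1, hrep _ h3, hM]
    have := Nat.mul_le_mul_left Q h2
    omega
  have hdep : ¬ LinearIndependent K v := fun hli => by
    have := linearIndependent_le_span_aux' v hli (S : Set (Ω → K))
      (by rintro _ ⟨j, rfl⟩; exact hspan (hv j))
    simp only [Fintype.card_coe, Finset.coe_sort_coe] at this
    omega
  obtain ⟨c, hc, j₀, hj₀⟩ := Fintype.not_linearIndependent_iff.1 hdep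
  have hQ0 : 0 < Q := by omega
  choose c' hc' using fun j => IsAlgClosed.exists_pow_nat_eq (c j) hQ0
  let e : I → ι → ℕ := fun j => rep j.1.1 + Q • rep j.1.2
  have hwt : ∀ j, weightOf w (e j) = j.1.1 + Q * j.1.2 := fun j => by
    obtain ⟨h1, h2, h3, h4⟩ := hI j.1 j.2
    rw [weightOf_add, weightOf_smul, hrep _ h1, hrep _ h3]
  obtain ⟨j, -, hj⟩ := hasWeight_sum (K := K) (x := x) (w := w) Finset.univ e
    (fun j _ k _ h => by
      obtain ⟨h1, h2, h3, h4⟩ := hI j.1 j.2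
      obtain ⟨k1, k2, k3, k4⟩ := hI k.1 k.2
      simp only [hwt] at h
      have hmod := congrArg (· % Q) h
      simp only [Nat.add_mul_mod_self_left] at hmod
      rw [Nat.mod_eq_of_lt (by omega), Nat.mod_eq_of_lt (by omega)] at hmod
      rw [hmod] at h
      exact Subtype.ext (Prod.ext hmod (Nat.eq_of_mul_eq_mul_left hQ0 (Nat.add_left_cancel h))))
    c' ⟨j₀, Finset.mem_univ _, fun h => hj₀ (by rw [← hc', h, zero_pow hQ0.ne'])⟩
  have hle := card_zeros_le H hx hj Z fun P hP => by
    rw [← pow_eq_zero_iff hQ0.ne', ← hφ, ← Pi.zero_apply (M := fun _ => K) P, ← hc]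
    simp only [Finset.sum_apply, Pi.smul_apply, smul_eq_mul, map_sum, map_mul, v, e]
    refine Finset.sum_congr rfl fun j _ => ?_
    rw [hφ, hc', monomialAt_add, monomialAt_smul, monomialAt_smul]
    simp only [Pi.mul_apply, Pi.pow_apply, hφ]
    rw [mul_pow, ← pow_mul]
    congr 2
    simp only [monomialAt, Finset.prod_apply, Pi.pow_apply, y, ← Finset.prod_pow]
    refine Finset.prod_congr rfl fun i _ => ?_
    rw [← hZ P hP, ← pow_mul, ← pow_mul]
    ring
  rw [hwt] at hle
  obtain ⟨h1, h2, h3, h4⟩ := hI j.1 j.2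
  have := Nat.mul_le_mul_left Q h4
  have h5 : Q * (Q + 2 * N) = Q * Q + 2 * N * Q := by ring
  have h6 : (2 * N + 1) * Q = 2 * N * Q + Q := by ring
  omega

end Stepanov

section ArtinSchreierTower

/-- The weight of the `j`-th coordinate of the tower: its pole order at infinity. -/
def towerWeight (q k : ℕ) (j : Fin (k + 1)) : ℕ :=
  q ^ (k - j) * ∑ t ∈ Finset.range (j + 1), q ^ t

lemma towerWeight_zero (q k : ℕ) : towerWeight q k 0 = q ^ k := by simp [towerWeight]

lemma mul_towerWeight_succ (q k : ℕ) (i : Fin k) :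
    q * towerWeight q k i.succ = q * towerWeight q k 0 + towerWeight q k i.castSucc := by
  obtain ⟨s, hs⟩ : ∃ s, k = i + 1 + s := ⟨k - (i + 1), by omega⟩
  have h1 : k - (i + 1) = s := by omega
  have h2 : k - (i : ℕ) = s + 1 := by omega
  simp only [towerWeight, Fin.val_succ, Fin.val_castSucc, h1, h2, Fin.val_zero, zero_add,
    Finset.range_one, Finset.sum_singleton, pow_zero, mul_one, tsub_zero]
  rw [Finset.sum_range_succ _ (i + 1)]
  have : q ^ k = q ^ (i + 1 : ℕ) * q ^ s := by rw [← pow_add, ← hs]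
  rw [this]
  ring

lemma towerWeight_pos {q : ℕ} (hq : 0 < q) (k : ℕ) (j : Fin (k + 1)) : 0 < towerWeight q k j := by
  unfold towerWeight
  refine Nat.mul_pos (pow_pos hq _) (Finset.sum_pos (fun _ _ => pow_pos hq _) (by simp))

lemma eq_of_weightOf_towerWeight_eq {q k : ℕ} (hq : 0 < q) {e e' : Fin (k + 1) → ℕ}
    (he : ∀ i, i ≠ 0 → e i < q) (he' : ∀ i, i ≠ 0 → e' i < q)
    (h : weightOf (towerWeight q k) e = weightOf (towerWeight q k) e') : e = e' := by
  have hsum : ∑ j, ((e j : ℤ) - e' j) * towerWeight q k j = 0 := by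
    simp only [weightOf] at h
    simp only [sub_mul, Finset.sum_sub_distrib]
    rw [sub_eq_zero]
    exact_mod_cast h
  have key : ∀ t, ∀ i : Fin (k + 1), (i : ℕ) + t = k → e i = e' i := by
    intro t
    induction t using Nat.strong_induction_on with
    | _ t ih =>
      intro i hi
      have hgt : ∀ j : Fin (k + 1), i < j → e j = e' j := fun j hj =>
        ih (k - j) (by omega) j (by omega)
      rw [← Finset.add_sum_erase _ _ (Finset.mem_univ i)] at hsum
      by_cases h0 : i = 0
      · subst h0
        rw [Finset.sum_eq_zero, add_zero, mul_eq_zero] at hsum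
        · rcases hsum with h | h
          · omega
          · have := towerWeight_pos hq k 0
            omega
        · intro j hj
          rw [hgt j (Fin.pos_of_ne_zero (Finset.ne_of_mem_erase hj)), sub_self, zero_mul]
      · have hdvd : (q : ℤ) ^ (t + 1) ∣ ((e i : ℤ) - e' i) * towerWeight q k i := by
          rw [eq_neg_of_add_eq_zero_left hsum, dvd_neg]
          refine Finset.dvd_sum fun j hj => ?_
          rcases lt_or_gt_of_ne (Finset.ne_of_mem_erase hj) with hj | hj
          · refine Dvd.dvd.mul_left ?_ _
            rw [towerWeight, Nat.cast_mul, Nat.cast_pow]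
            exact Dvd.dvd.mul_right (pow_dvd_pow _ (by omega)) _
          · simp [hgt j hj]
        have hki : k - (i : ℕ) = t := by omega
        rw [towerWeight, hki, Finset.sum_range_succ', pow_zero] at hdvd
        push_cast at hdvd
        rw [pow_succ, mul_left_comm] at hdvd
        have h1 := Int.dvd_of_mul_dvd_mul_left (pow_ne_zero t (by exact_mod_cast hq.ne')) hdvd
        simp only [pow_succ, ← Finset.sum_mul] at h1
        have h2 : (q : ℤ) ∣ (e i : ℤ) - e' i := by
          have h3 : (q : ℤ) ∣ ((e i : ℤ) - e' i) * ((∑ t ∈ Finset.range i, (q : ℤ) ^ t) * q) :=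
            Dvd.dvd.mul_left (Dvd.intro_left _ rfl) _
          rw [mul_add, mul_one] at h1
          exact (dvd_add_right h3).1 h1
        have h4 := Int.eq_zero_of_abs_lt_dvd h2 (by
          have := he i h0
          have := he' i h0
          rw [abs_lt]
          constructor <;> omega)
        omega
  funext i
  exact key (k - i) i (by omega)

variable {K R : Type*} [Field K] [CommRing R] [Algebra K R]

/-- The monomials on an Artin–Schreier tower `x (i+1) ^ q - x (i+1) = (x 0 ^ q - x 0) * x i`
are separated by their weights, up to smaller weight. -/
theorem weightsSeparate_tower {q k : ℕ} (hq : 2 ≤ q) {x : Fin (k + 1) → R}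
    (hx : ∀ i : Fin k, x i.succ ^ q = x i.succ + (x 0 ^ q - x 0) * x i.castSucc) :
    WeightsSeparate K x (towerWeight q k) := by
  set w := towerWeight q k
  have hpos := towerWeight_pos (by omega : 0 < q) k
  have hred : ∀ N, ∀ e : Fin (k + 1) → ℕ, weightOf (fun j : Fin (k + 1) => (j : ℕ)) e = N →
      ∃ e', (∀ i, i ≠ 0 → e' i < q) ∧ weightOf w e' = weightOf w e ∧
        monomialAt x e - monomialAt x e' ∈ weightLT K x w (weightOf w e) := by
    intro N
    induction N using Nat.strong_induction_on with
    | _ N ih =>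
      rintro e rfl
      by_cases hlt : ∀ i, i ≠ 0 → e i < q
      · exact ⟨e, hlt, rfl, by simp⟩
      · push Not at hlt
        obtain ⟨i', hi', hle⟩ := hlt
        obtain ⟨i, rfl⟩ := Fin.exists_succ_eq.2 hi'
        obtain ⟨f, rfl⟩ : ∃ f, e = f + q • Pi.single i.succ 1 := by
          refine ⟨e - q • Pi.single i.succ 1, funext fun j => ?_⟩
          by_cases h : j = i.succ
          · subst h
            simp
            omega
          · simp [h]
        have hw := mul_towerWeight_succ q k i
        have hwt : weightOf w (f + q • Pi.single 0 1 + Pi.single i.castSucc 1) =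
            weightOf w (f + q • Pi.single i.succ 1) := by
          simp only [weightOf_add, weightOf_smul, weightOf_single]
          change _ + q * towerWeight q k 0 + towerWeight q k _ = _ + q * towerWeight q k _
          omega
        obtain ⟨e', h1, h2, h3⟩ := ih (weightOf (fun j : Fin (k + 1) => (j : ℕ))
            (f + q • Pi.single 0 1 + Pi.single i.castSucc 1)) (by
          simp only [weightOf_add, weightOf_smul, weightOf_single, Fin.val_zero, mul_zero,
            Fin.val_succ, Fin.val_castSucc]
          nlinarith) _ rfl
        refine ⟨e', h1, h2.trans hwt, ?_⟩
        rw [hwt] at h3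
        rw [← sub_add_sub_cancel _ (monomialAt x
          (f + q • Pi.single 0 1 + Pi.single i.castSucc 1))]
        refine Submodule.add_mem _ ?_ h3
        have : monomialAt x (f + q • Pi.single i.succ 1) -
            monomialAt x (f + q • Pi.single 0 1 + Pi.single i.castSucc 1) =
            monomialAt x f * (x i.succ - x 0 * x i.castSucc) := by
          simp only [monomialAt_add, monomialAt_smul, monomialAt_single, hx]
          ring
        rw [this, weightOf_add, weightOf_smul, weightOf_single]
        refine mul_mem_weightLT (monomialAt_mem (Nat.lt_succ_self _))
          (Submodule.sub_mem _ (weightLT_mono ?_ (coord_mem_weightLT i.succ))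
            (mul_mem_weightLT (coord_mem_weightLT 0) (coord_mem_weightLT i.castSucc) ?_))
          (b := q * w i.succ) (by omega)
        · have := hpos i.succ
          change towerWeight q k _ + 1 ≤ q * towerWeight q k _
          nlinarith
        · have := hpos 0
          change towerWeight q k _ + 1 + (towerWeight q k _ + 1) ≤ q * towerWeight q k _ + 1
          nlinarith
  intro e e' h
  obtain ⟨f, h1, h2, h3⟩ := hred _ e rfl
  obtain ⟨f', h1', h2', h3'⟩ := hred _ e' rfl
  obtain rfl := eq_of_weightOf_towerWeight_eq (by omega) h1 h1' (by rw [h2, h2', h])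
  rw [← h] at h3'
  simpa using Submodule.sub_mem _ h3 h3'

lemma exists_weightOf_towerWeight_eq (q k : ℕ) :
    ∃ N, ∀ n, N ≤ n → ∃ e, weightOf (towerWeight q k) e = n := by
  let s : Set ℕ := Set.range (towerWeight q k)
  obtain ⟨N, hN⟩ := Nat.exists_mem_closure_of_ge s
  have hgcd : Nat.setGcd s = 1 := by
    have h1 : Nat.setGcd s ∣ q ^ k := Nat.setGcd_dvd_of_mem ⟨0, towerWeight_zero q k⟩
    have h2 : Nat.setGcd s ∣ ∑ t ∈ Finset.range (k + 1), q ^ t :=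
      Nat.setGcd_dvd_of_mem ⟨Fin.last k, by simp [towerWeight]⟩
    refine Nat.eq_one_of_dvd_coprimes (a := q ^ k) ?_ h1 h2
    refine Nat.Coprime.pow_left k ?_
    rw [Finset.sum_range_succ', pow_zero]
    simp only [pow_succ, ← Finset.sum_mul]
    simp
  refine ⟨N, fun n hn => ?_⟩
  have hmem := hN n hn (by rw [hgcd]; exact one_dvd n)
  clear hn
  induction hmem using AddSubmonoid.closure_induction with
  | mem y hy =>
    obtain ⟨i, rfl⟩ := hy
    exact ⟨_, weightOf_single i⟩
  | zero => exact ⟨0, by simp [weightOf]⟩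
  | add a b _ _ ha hb =>
    obtain ⟨e, rfl⟩ := ha
    obtain ⟨e', rfl⟩ := hb
    exact ⟨e + e', weightOf_add e e'⟩

end ArtinSchreierTower

/-! ### Truncated one-units -/

/-- The coefficients `a 1, …, a d` of a power series `1 + a 1 * X + ⋯` modulo `X ^ (d + 1)`. -/
def TruncUnits (d : ℕ) (R : Type*) : Type _ := Fin d → R

namespace TruncUnits

noncomputable section

variable {d : ℕ} {R S : Type*}

instance [Fintype R] : Fintype (TruncUnits d R) := inferInstanceAs (Fintype (Fin d → R))

lemma card_eq [Fintype R] : Fintype.card (TruncUnits d R) = Fintype.card R ^ d := by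
  change Fintype.card (Fin d → R) = _
  simp

variable [Field R] [Field S]

/-- The one-unit given by a power series with constant term `1`. -/
def ofSeries (f : PowerSeries R) : TruncUnits d R := fun i => PowerSeries.coeff (i + 1) f

/-- The polynomial representative of a truncated one-unit. -/
def toSeries (a : TruncUnits d R) : PowerSeries R :=
  PowerSeries.mk fun k => if k = 0 then 1 else if h : k - 1 < d then a ⟨k - 1, h⟩ else 0

lemma coeff_zero_toSeries (a : TruncUnits d R) : PowerSeries.coeff 0 a.toSeries = 1 := by
  simp [toSeries]

lemma constantCoeff_toSeries (a : TruncUnits d R) :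
    PowerSeries.constantCoeff a.toSeries = 1 := by
  rw [← PowerSeries.coeff_zero_eq_constantCoeff_apply, coeff_zero_toSeries]

lemma coeff_succ_toSeries (a : TruncUnits d R) (i : Fin d) :
    PowerSeries.coeff (i + 1) a.toSeries = a i := by
  simp [toSeries]

lemma ofSeries_toSeries (a : TruncUnits d R) : ofSeries a.toSeries = a :=
  funext fun i => coeff_succ_toSeries a i

lemma ofSeries_eq_iff {f g : PowerSeries R} (hf : PowerSeries.constantCoeff f = 1)
    (hg : PowerSeries.constantCoeff g = 1) :
    (ofSeries f : TruncUnits d R) = ofSeries g ↔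
      ∀ k ≤ d, PowerSeries.coeff k f = PowerSeries.coeff k g := by
  constructor
  · intro h k hk
    rcases k with _ | k
    · simp [hf, hg]
    · exact congrFun h ⟨k, hk⟩
  · exact fun h => funext fun i => h _ i.2

instance : Mul (TruncUnits d R) := ⟨fun a b => ofSeries (a.toSeries * b.toSeries)⟩
instance : One (TruncUnits d R) := ⟨ofSeries 1⟩
instance : Inv (TruncUnits d R) := ⟨fun a => ofSeries a.toSeries⁻¹⟩

lemma mul_def (a b : TruncUnits d R) : a * b = ofSeries (a.toSeries * b.toSeries) := rfl
lemma one_def : (1 : TruncUnits d R) = ofSeries 1 := rfl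

lemma ofSeries_mul {f g : PowerSeries R} (hf : PowerSeries.constantCoeff f = 1)
    (hg : PowerSeries.constantCoeff g = 1) :
    (ofSeries (f * g) : TruncUnits d R) = ofSeries f * ofSeries g := by
  have h : ∀ {f : PowerSeries R}, PowerSeries.constantCoeff f = 1 → ∀ k ≤ d,
      PowerSeries.coeff k f = PowerSeries.coeff k (ofSeries f : TruncUnits d R).toSeries :=
    fun hf => (ofSeries_eq_iff hf (constantCoeff_toSeries _)).1 (ofSeries_toSeries _).symm
  refine (ofSeries_eq_iff (by simp [hf, hg])
    (by simp [constantCoeff_toSeries])).2 fun k hk => ?_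
  rw [PowerSeries.coeff_mul, PowerSeries.coeff_mul]
  refine Finset.sum_congr rfl fun p hp => ?_
  have hp := Finset.HasAntidiagonal.mem_antidiagonal.1 hp
  rw [h hf _ (by omega), h hg _ (by omega)]

instance : CommGroup (TruncUnits d R) where
  mul_assoc a b c := by
    rw [← ofSeries_toSeries a, ← ofSeries_toSeries b, ← ofSeries_toSeries c,
      ← ofSeries_mul, ← ofSeries_mul, ← ofSeries_mul, ← ofSeries_mul, mul_assoc] <;>
      simp [constantCoeff_toSeries]
  one_mul a := by
    rw [one_def]
    conv_lhs => rw [← ofSeries_toSeries a, ← ofSeries_mul (by simp) (constantCoeff_toSeries a)]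
    rw [one_mul, ofSeries_toSeries]
  mul_one a := by
    rw [one_def]
    conv_lhs => rw [← ofSeries_toSeries a, ← ofSeries_mul (constantCoeff_toSeries a) (by simp)]
    rw [mul_one, ofSeries_toSeries]
  inv_mul_cancel a := by
    have h : ofSeries a.toSeries⁻¹ * ofSeries a.toSeries = (1 : TruncUnits d R) := by
      rw [← ofSeries_mul (by simp [constantCoeff_toSeries]) (constantCoeff_toSeries a),
        PowerSeries.inv_mul_cancel _ (by simp [constantCoeff_toSeries])]
      rfl
    rwa [ofSeries_toSeries] at h
  mul_comm a b := by rw [mul_def, mul_def, mul_comm]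

lemma apply_eq_ofSeries_map (f : R →+* S) (a : TruncUnits d R) :
    (fun i => f (a i)) = (ofSeries (PowerSeries.map f a.toSeries) : TruncUnits d S) :=
  funext fun i => by simp [ofSeries, coeff_succ_toSeries]

/-- Functoriality of `TruncUnits`. -/
def map (f : R →+* S) : TruncUnits d R →* TruncUnits d S where
  toFun a := ofSeries (PowerSeries.map f a.toSeries)
  map_one' := by
    rw [← apply_eq_ofSeries_map]
    funext i
    simp [one_def, ofSeries, PowerSeries.coeff_one]
  map_mul' a b := by
    have hc : ∀ a : TruncUnits d R,
        PowerSeries.constantCoeff (PowerSeries.map f a.toSeries) = 1 := fun a => by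
      rw [← PowerSeries.coeff_zero_eq_constantCoeff_apply]
      simp [constantCoeff_toSeries]
    rw [← ofSeries_mul (hc a) (hc b), ← map_mul, ← apply_eq_ofSeries_map]
    funext i
    rw [mul_def, ofSeries, ofSeries, ← PowerSeries.coeff_map, map_mul]

lemma map_apply (f : R →+* S) (a : TruncUnits d R) (i : Fin d) : map f a i = f (a i) :=
  congrFun (apply_eq_ofSeries_map f a).symm i

lemma map_injective (f : R →+* S) : Function.Injective (map (d := d) f) := fun _ _ h =>
  funext fun i => f.injective (by rw [← map_apply, ← map_apply, h])

lemma map_ofSeries (f : R →+* S) (g : PowerSeries R) :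
    map (d := d) f (ofSeries g) = ofSeries (PowerSeries.map f g) := by
  funext i
  simp [map_apply, ofSeries]

/-- The class of `1 - z * X`. -/
def lin (z : R) : TruncUnits d R := ofSeries (1 - PowerSeries.C z * PowerSeries.X)

lemma map_lin (f : R →+* S) (z : R) : map (d := d) f (lin z) = lin (f z) := by
  simp [lin, map_ofSeries]

lemma mul_lin_apply (a : TruncUnits d R) (z : R) (i : Fin d) :
    (a * lin z : TruncUnits d R) i = a i - z * PowerSeries.coeff i a.toSeries := by
  conv_lhs => rw [← ofSeries_toSeries a, lin, ← ofSeries_mul (constantCoeff_toSeries a)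
    (by simp)]
  rw [ofSeries, mul_sub, mul_one, map_sub, mul_left_comm, PowerSeries.coeff_C_mul,
    PowerSeries.coeff_succ_mul_X, coeff_succ_toSeries]

lemma lin_injective {k : ℕ} : Function.Injective (lin : R → TruncUnits (k + 1) R) := by
  intro z z' h
  have := congrFun h 0
  simpa [lin, ofSeries, PowerSeries.coeff_one] using this

end

end TruncUnits

/-! ### Norms of truncated one-units over a finite field -/

section Norm

variable (F K : Type*) [Field F] [Fintype F] [Field K] [Algebra F K]

/-- The `ℓ`-th power of the Frobenius of `F` acting on `K`. -/
noncomputable def frobPow (ℓ : ℕ) : K →+* K := (FiniteField.frobeniusAlgHom F K ^ ℓ).toRingHom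

lemma frobPow_apply (ℓ : ℕ) (z : K) : frobPow F K ℓ z = z ^ Fintype.card F ^ ℓ := by
  change (FiniteField.frobeniusAlgHom F K ^ ℓ) z = _
  rw [AlgHom.coe_pow, FiniteField.coe_frobeniusAlgHom, pow_iterate]

lemma frobPow_algebraMap (ℓ : ℕ) (a : F) :
    frobPow F K ℓ (algebraMap F K a) = algebraMap F K a :=
  (FiniteField.frobeniusAlgHom F K ^ ℓ).commutes a

variable {K} {d : ℕ}

lemma map_frobPow_map_algebraMap (ℓ : ℕ) (b : TruncUnits d F) :
    TruncUnits.map (frobPow F K ℓ) (TruncUnits.map (algebraMap F K) b) =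
      TruncUnits.map (algebraMap F K) b := by
  funext i
  simp only [TruncUnits.map_apply, frobPow_algebraMap]

/-- The product of the classes of `1 - z ^ (q ^ i) * X` for `i < ℓ`. -/
noncomputable def linNorm (d ℓ : ℕ) (z : K) : TruncUnits d K :=
  ∏ i ∈ Finset.range ℓ, TruncUnits.lin (z ^ Fintype.card F ^ i)

lemma map_frobPow_eq_mul_linNorm {g : TruncUnits d K} {z : K}
    (h : TruncUnits.map (frobPow F K 1) g = g * TruncUnits.lin z) (ℓ : ℕ) :
    TruncUnits.map (frobPow F K ℓ) g = g * linNorm F d ℓ z := by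
  induction ℓ with
  | zero =>
    simp only [linNorm, Finset.range_zero, Finset.prod_empty, mul_one]
    funext i
    simp [TruncUnits.map_apply, frobPow_apply]
  | succ ℓ ih =>
    have h1 : TruncUnits.map (frobPow F K (ℓ + 1)) g =
        TruncUnits.map (frobPow F K ℓ) (TruncUnits.map (frobPow F K 1) g) := by
      funext i
      simp [TruncUnits.map_apply, frobPow_apply, ← pow_mul, pow_succ']
    rw [h1, h, map_mul, ih, TruncUnits.map_lin, frobPow_apply, linNorm, linNorm,
      Finset.prod_range_succ, mul_assoc]

/-- Lang's theorem for truncated one-units. -/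
lemma exists_map_frobPow_eq_mul_lin [IsAlgClosed K] (z : K) :
    ∃ g : TruncUnits d K, TruncUnits.map (frobPow F K 1) g = g * TruncUnits.lin z := by
  have hroot : ∀ c : K, ∃ y, y ^ Fintype.card F = y - c := fun c => by
    have h2 := Fintype.one_lt_card (α := F)
    have hdeg : (Polynomial.X ^ Fintype.card F - (Polynomial.X - Polynomial.C c)).degree =
        (Fintype.card F : WithBot ℕ) := by
      rw [Polynomial.degree_sub_eq_left_of_degree_lt] <;> rw [Polynomial.degree_X_pow]
      rw [Polynomial.degree_X_sub_C]
      exact_mod_cast h2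
    obtain ⟨y, hy⟩ := IsAlgClosed.exists_root _ (by
      rw [hdeg]
      exact_mod_cast (by omega : Fintype.card F ≠ 0))
    refine ⟨y, ?_⟩
    simpa [Polynomial.IsRoot, sub_eq_zero] using hy
  choose root hr using hroot
  let a : ℕ → K := fun k => Nat.rec 1 (fun _ y => root (z * y)) k
  let g : TruncUnits d K := fun i => a (i + 1)
  refine ⟨g, funext fun i => ?_⟩
  have hg : PowerSeries.coeff i g.toSeries = a i := by
    rcases i with ⟨_ | i, hi⟩
    · exact TruncUnits.coeff_zero_toSeries g
    · exact TruncUnits.coeff_succ_toSeries g ⟨i, by omega⟩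
  rw [TruncUnits.mul_lin_apply, hg, TruncUnits.map_apply, frobPow_apply, pow_one]
  exact hr _

end Norm

section Fibres

variable (F K : Type*) [Field F] [Fintype F] [Field K] [Algebra F K] (k : ℕ)

/-- The truncated one-units `g` for which `g ^ φ / g` is linear. -/
def LangCurve : Type _ :=
  {g : TruncUnits (k + 1) K // ∃ z, TruncUnits.map (frobPow F K 1) g = g * TruncUnits.lin z}

variable {F K k}

lemma LangCurve.tower (P : LangCurve F K k) (i : Fin k) :
    P.1 i.succ ^ Fintype.card F = P.1 i.succ +
      (P.1 0 ^ Fintype.card F - P.1 0) * P.1 i.castSucc := by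
  obtain ⟨g, z, hg⟩ := P
  have h : ∀ i, g i ^ Fintype.card F = g i - z * PowerSeries.coeff i g.toSeries := fun i => by
    rw [← TruncUnits.mul_lin_apply, ← hg, TruncUnits.map_apply, frobPow_apply, pow_one]
  have h0 : g 0 ^ Fintype.card F = g 0 - z := by
    rw [h]
    simp [TruncUnits.constantCoeff_toSeries]
  have hc : PowerSeries.coeff (i.succ : ℕ) g.toSeries = g i.castSucc :=
    TruncUnits.coeff_succ_toSeries g i.castSucc
  change g i.succ ^ _ = g i.succ + (g 0 ^ _ - g 0) * g i.castSucc
  rw [h, h0, hc]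
  ring

/-- Translation by a one-unit over `F`. -/
noncomputable def LangCurve.translate (b : TruncUnits (k + 1) F) (P : LangCurve F K k) :
    LangCurve F K k :=
  ⟨P.1 * TruncUnits.map (algebraMap F K) b, by
    obtain ⟨g, z, hg⟩ := P
    exact ⟨z, by simp only [map_mul, hg, map_frobPow_map_algebraMap, mul_right_comm]⟩⟩

lemma towerWeight_mono (q : ℕ) : Monotone (towerWeight q k) := by
  refine Fin.monotone_iff_le_succ.2 fun i => ?_
  obtain ⟨s, hs⟩ : ∃ s, k = i + 1 + s := ⟨k - (i + 1), by omega⟩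
  have h1 : k - (i + 1) = s := by omega
  have h2 : k - (i : ℕ) = s + 1 := by omega
  simp only [towerWeight, Fin.val_succ, Fin.val_castSucc, h1, h2]
  rw [Finset.sum_range_succ' _ ((i : ℕ) + 1), pow_succ, mul_assoc]
  refine Nat.mul_le_mul_left _ ?_
  simp [Finset.mul_sum, pow_succ']

lemma LangCurve.coord_translate_mem (b : TruncUnits (k + 1) F) (i : Fin (k + 1)) :
    (fun P : LangCurve F K k => (P.translate b).1 i) ∈
      weightLT K (fun i (P : LangCurve F K k) => P.1 i) (towerWeight (Fintype.card F) k)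
        (towerWeight (Fintype.card F) k i + 1) := by
  set W := weightLT K (fun i (P : LangCurve F K k) => P.1 i) (towerWeight (Fintype.card F) k)
  have h : (fun P : LangCurve F K k => (P.translate b).1 i) =
      ∑ p ∈ Finset.HasAntidiagonal.antidiagonal ((i : ℕ) + 1),
        PowerSeries.coeff p.2 (TruncUnits.map (algebraMap F K) b).toSeries •
          fun P : LangCurve F K k => PowerSeries.coeff p.1 P.1.toSeries := by
    funext P
    change (P.1 * TruncUnits.map (algebraMap F K) b : TruncUnits (k + 1) K) i = _
    rw [TruncUnits.mul_def, TruncUnits.ofSeries, PowerSeries.coeff_mul, Finset.sum_apply]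
    exact Finset.sum_congr rfl fun p _ => mul_comm _ _
  rw [h]
  refine Submodule.sum_mem _ fun p hp => Submodule.smul_mem _ _ ?_
  have hp := Finset.HasAntidiagonal.mem_antidiagonal.1 hp
  obtain ⟨_ | j, p2⟩ := p
  · have : (fun P : LangCurve F K k => PowerSeries.coeff 0 P.1.toSeries) = 1 :=
      funext fun P => TruncUnits.coeff_zero_toSeries _
    simp only [this]
    exact weightLT_mono (by omega) one_mem_weightLT
  · have hj : j < k + 1 := by have := i.2; simp only at hp; omega
    have : (fun P : LangCurve F K k => PowerSeries.coeff (j + 1) P.1.toSeries) =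
        fun P => P.1 ⟨j, hj⟩ :=
      funext fun P => TruncUnits.coeff_succ_toSeries P.1 ⟨j, hj⟩
    simp only [this]
    refine weightLT_mono ?_ (coord_mem_weightLT
      (x := fun i (P : LangCurve F K k) => P.1 i) (⟨j, hj⟩ : Fin (k + 1)))
    exact Nat.succ_le_succ (towerWeight_mono _ (Fin.mk_le_of_le_val
      (by simp only at hp; omega)))

variable (F K k)

/-- The fibres of the norm map `z ↦ ∏ (1 - z ^ (q ^ i) X)` over one-units with coefficients in
`F` are not much larger than expected. -/
theorem exists_card_linNorm_fibre_le [IsAlgClosed K] :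
    ∃ C r₀ : ℕ, ∀ r ≥ r₀, ∀ (b : TruncUnits (k + 1) F) (Z : Finset K),
      (∀ z ∈ Z, linNorm F (k + 1) (2 * r) z = TruncUnits.map (algebraMap F K) b) →
      Z.card * Fintype.card F ^ (k + 1) ≤
        Fintype.card F ^ (2 * r) + C * Fintype.card F ^ r := by
  set q := Fintype.card F
  have hq2 : 2 ≤ q := Fintype.one_lt_card
  obtain ⟨N, hN⟩ := exists_weightOf_towerWeight_eq q k
  refine ⟨2 * N + 1, N * N + 3 * N + 1, fun r hr b Z hZ => ?_⟩
  choose lang hlang using fun z : K => exists_map_frobPow_eq_mul_lin F (d := k + 1) z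
  let P : K × TruncUnits (k + 1) F → LangCurve F K k := fun zc =>
    LangCurve.translate zc.2 ⟨lang zc.1, zc.1, hlang zc.1⟩
  have hPinj : Function.Injective P := by
    rintro ⟨z, c⟩ ⟨z', c'⟩ h
    have h1 : lang z * TruncUnits.map (algebraMap F K) c =
      lang z' * TruncUnits.map (algebraMap F K) c' := congrArg Subtype.val h
    have h2 := congrArg (TruncUnits.map (frobPow F K 1)) h1
    simp only [map_mul, hlang, map_frobPow_map_algebraMap] at h2
    have h3 : lang z * TruncUnits.map (algebraMap F K) c * TruncUnits.lin z =
        lang z * TruncUnits.map (algebraMap F K) c * TruncUnits.lin z' := by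
      rw [mul_right_comm, h2, h1, mul_right_comm]
    obtain rfl := TruncUnits.lin_injective (mul_left_cancel h3)
    rw [TruncUnits.map_injective _ (mul_left_cancel h1)]
  have hcard : (Finset.image P (Z ×ˢ Finset.univ)).card = Z.card * q ^ (k + 1) := by
    rw [Finset.card_image_of_injective _ hPinj, Finset.card_product, Finset.card_univ,
      TruncUnits.card_eq]
  rw [← hcard, two_mul, pow_add]
  refine card_le_of_frobenius_eq (x := fun i (P : LangCurve F K k) => P.1 i)
    (weightsSeparate_tower hq2 fun i => ?_) (fun P Q h => Subtype.ext (funext h))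
    (LangCurve.translate b) (LangCurve.coord_translate_mem b) hN
    (hr.trans_lt (Nat.lt_pow_self hq2)) (frobPow F K r) (frobPow_apply F K r) _ ?_
  · funext P
    exact P.tower i
  · intro Q hQ i
    obtain ⟨⟨z, c⟩, hzc, rfl⟩ := Finset.mem_image.1 hQ
    have hz := (Finset.mem_product.1 hzc).1
    have h1 := map_frobPow_eq_mul_linNorm F (hlang z) (2 * r)
    rw [hZ z hz] at h1
    rw [← pow_add, ← two_mul, ← frobPow_apply F K, ← TruncUnits.map_apply]
    refine congrFun (?_ : TruncUnits.map (frobPow F K (2 * r))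
      (lang z * TruncUnits.map (algebraMap F K) c) = lang z * TruncUnits.map (algebraMap F K) c *
        TruncUnits.map (algebraMap F K) b) i
    rw [map_mul, h1, map_frobPow_map_algebraMap, mul_right_comm]

end Fibres

section PolyClass

variable {F L : Type*} [Field F] [Field L] {d : ℕ}

/-- The class of `X ^ deg p * p (1 / X)`, recording the `d` coefficients of the monic polynomial
`p` after the leading one. -/
noncomputable def polyClass (d : ℕ) (p : Polynomial F) : TruncUnits d F :=
  TruncUnits.ofSeries (p.reverse : PowerSeries F)

lemma constantCoeff_reverse {p : Polynomial F} (hp : p.Monic) :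
    PowerSeries.constantCoeff (p.reverse : PowerSeries F) = 1 := by
  rw [← PowerSeries.coeff_zero_eq_constantCoeff_apply, Polynomial.coeff_coe,
    Polynomial.coeff_zero_reverse, hp]

lemma polyClass_mul {p r : Polynomial F} (hp : p.Monic) (hr : r.Monic) :
    polyClass d (p * r) = polyClass d p * polyClass d r := by
  rw [polyClass, Polynomial.reverse_mul_of_domain, Polynomial.coe_mul,
    TruncUnits.ofSeries_mul (constantCoeff_reverse hp) (constantCoeff_reverse hr)]
  rfl

lemma polyClass_one : polyClass d (1 : Polynomial F) = 1 := by
  rw [polyClass, ← Polynomial.C_1, Polynomial.reverse_C, Polynomial.C_1, Polynomial.coe_one]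
  rfl

lemma polyClass_prod {J : Type*} (s : Finset J) (f : J → Polynomial F)
    (hf : ∀ j ∈ s, (f j).Monic) : polyClass d (∏ j ∈ s, f j) = ∏ j ∈ s, polyClass d (f j) := by
  induction s using Finset.induction_on with
  | empty => simp [polyClass_one]
  | insert j s hj ih =>
    rw [Finset.prod_insert hj, Finset.prod_insert hj, polyClass_mul (hf j (by simp))
      (Polynomial.monic_prod_of_monic _ _ fun i hi => hf i (by simp [hi])),
      ih fun i hi => hf i (by simp [hi])]

lemma polyClass_X_sub_C (z : F) :
    polyClass d (Polynomial.X - Polynomial.C z) = TruncUnits.lin z := by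
  have h : (Polynomial.X - Polynomial.C z).reverse = 1 - Polynomial.C z * Polynomial.X := by
    ext i
    rw [Polynomial.coeff_reverse, Polynomial.natDegree_X_sub_C]
    rcases i with _ | _ | i
    · rw [Polynomial.revAt_le (by omega)]
      simp
    · rw [Polynomial.revAt_le (by omega)]
      simp [Polynomial.coeff_one]
    · rw [Polynomial.revAt_eq_self_of_lt (by omega)]
      simp [Polynomial.coeff_one, Polynomial.coeff_X]
  rw [polyClass, h, TruncUnits.lin]
  simp

lemma map_polyClass (f : F →+* L) (p : Polynomial F) :
    TruncUnits.map f (polyClass d p) = polyClass d (p.map f) := by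
  funext i
  simp [TruncUnits.map_apply, polyClass, TruncUnits.ofSeries, Polynomial.coeff_coe,
    Polynomial.coeff_reverse]

end PolyClass

section NormPoly

variable (F : Type*) {K : Type*} [Field F] [Fintype F] [Field K] [Algebra F K]

open Polynomial in
lemma exists_algebraMap_eq_of_pow_card_eq {c : K} (hc : c ^ Fintype.card F = c) :
    ∃ a : F, algebraMap F K a = c := by
  have hq : 1 < Fintype.card F := Fintype.one_lt_card
  have hne := FiniteField.X_pow_card_sub_X_ne_zero K hq
  have hroot : ∀ y : K, y ^ Fintype.card F = y →
      y ∈ (X ^ Fintype.card F - X : K[X]).roots.toFinset := fun y hy => by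
    simp [hne, hy]
  have h := Finset.eq_of_subset_of_card_le (s := Finset.univ.image (algebraMap F K))
    (t := (X ^ Fintype.card F - X : K[X]).roots.toFinset)
    (fun y hy => by
      obtain ⟨a, -, rfl⟩ := Finset.mem_image.1 hy
      exact hroot _ (by rw [← map_pow, FiniteField.pow_card]))
    (by
      rw [Finset.card_image_of_injective _ (algebraMap F K).injective, Finset.card_univ]
      refine (Multiset.toFinset_card_le _).trans ((card_roots' _).trans_eq ?_)
      exact FiniteField.X_pow_card_sub_X_natDegree_eq K hq)
  have := hroot c hc
  rw [← h] at this
  simpa using this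

lemma exists_map_eq_of_map_frobPow_eq {P : Polynomial K} (h : P.map (frobPow F K 1) = P) :
    ∃ p : Polynomial F, p.map (algebraMap F K) = P := by
  refine (Polynomial.mem_lifts P).1 ((Polynomial.lifts_iff_coeff_lifts P).2 fun n => ?_)
  obtain ⟨a, ha⟩ := exists_algebraMap_eq_of_pow_card_eq F (c := P.coeff n) (by
    conv_rhs => rw [← h, Polynomial.coeff_map, frobPow_apply, pow_one])
  exact ⟨a, ha⟩

/-- The polynomial `∏_{i < ℓ} (X - z ^ (q ^ i))`. -/
noncomputable def orbitPoly (ℓ : ℕ) (z : K) : Polynomial K :=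
  ∏ i ∈ Finset.range ℓ, (Polynomial.X - Polynomial.C (z ^ Fintype.card F ^ i))

omit [Field F] [Algebra F K] in
lemma orbitPoly_monic (ℓ : ℕ) (z : K) : (orbitPoly F ℓ z).Monic :=
  Polynomial.monic_prod_of_monic _ _ fun _ _ => Polynomial.monic_X_sub_C _

omit [Field F] [Algebra F K] in
lemma polyClass_orbitPoly (d ℓ : ℕ) (z : K) :
    polyClass d (orbitPoly F ℓ z) = linNorm F d ℓ z := by
  rw [orbitPoly, polyClass_prod _ _ fun _ _ => Polynomial.monic_X_sub_C _]
  simp only [polyClass_X_sub_C]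
  rfl

lemma map_frobPow_orbitPoly {ℓ : ℕ} {z : K} (hz : z ^ Fintype.card F ^ ℓ = z) :
    (orbitPoly F ℓ z).map (frobPow F K 1) = orbitPoly F ℓ z := by
  have h : (orbitPoly F ℓ z).map (frobPow F K 1) = ∏ i ∈ Finset.range ℓ,
      (Polynomial.X - Polynomial.C (z ^ Fintype.card F ^ (i + 1))) := by
    simp [orbitPoly, Polynomial.map_prod, frobPow_apply, ← pow_mul, pow_succ']
  have h1 := Finset.prod_range_succ
    (fun i => (Polynomial.X - Polynomial.C (z ^ Fintype.card F ^ i))) ℓ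
  rw [Finset.prod_range_succ', hz, pow_zero, pow_one] at h1
  rw [h]
  exact mul_right_cancel₀ (Polynomial.X_sub_C_ne_zero z) h1

/-- The norm of `X - z` from the degree `ℓ` extension of `F`, for `z` in that extension. -/
noncomputable def normPoly (ℓ : ℕ) (z : K) : Polynomial F :=
  if h : z ^ Fintype.card F ^ ℓ = z then
    (exists_map_eq_of_map_frobPow_eq F (map_frobPow_orbitPoly F h)).choose else 1

lemma map_normPoly {ℓ : ℕ} {z : K} (hz : z ^ Fintype.card F ^ ℓ = z) :
    (normPoly F ℓ z).map (algebraMap F K) = orbitPoly F ℓ z := by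
  rw [normPoly, dif_pos hz]
  exact (exists_map_eq_of_map_frobPow_eq F (map_frobPow_orbitPoly F hz)).choose_spec

lemma normPoly_monic {ℓ : ℕ} {z : K} (hz : z ^ Fintype.card F ^ ℓ = z) :
    (normPoly F ℓ z).Monic := by
  refine Polynomial.monic_of_injective (algebraMap F K).injective ?_
  rw [map_normPoly F hz]
  exact orbitPoly_monic F ℓ z

lemma natDegree_normPoly {ℓ : ℕ} {z : K} (hz : z ^ Fintype.card F ^ ℓ = z) :
    (normPoly F ℓ z).natDegree = ℓ := by
  rw [← Polynomial.natDegree_map (algebraMap F K), map_normPoly F hz, orbitPoly,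
    Polynomial.natDegree_prod_of_monic _ _ fun _ _ => Polynomial.monic_X_sub_C _]
  simp only [Polynomial.natDegree_X_sub_C, Finset.sum_const, Finset.card_range, smul_eq_mul,
    mul_one]

lemma map_polyClass_normPoly (d : ℕ) {ℓ : ℕ} {z : K} (hz : z ^ Fintype.card F ^ ℓ = z) :
    TruncUnits.map (algebraMap F K) (polyClass d (normPoly F ℓ z)) = linNorm F d ℓ z := by
  rw [map_polyClass, map_normPoly F hz, polyClass_orbitPoly]

variable (K)

/-- The elements of the degree `ℓ` extension of `F` inside `K`. -/
noncomputable def frobFixed (ℓ : ℕ) : Finset K :=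
  (Polynomial.X ^ Fintype.card F ^ ℓ - Polynomial.X : Polynomial K).roots.toFinset

variable {K}

omit [Algebra F K] in
lemma mem_frobFixed {ℓ : ℕ} (hℓ : ℓ ≠ 0) {z : K} :
    z ∈ frobFixed F K ℓ ↔ z ^ Fintype.card F ^ ℓ = z := by
  simp [frobFixed, FiniteField.X_pow_card_pow_sub_X_ne_zero K hℓ Fintype.one_lt_card,
    sub_eq_zero]

lemma card_frobFixed [IsAlgClosed K] {ℓ : ℕ} (hℓ : ℓ ≠ 0) :
    (frobFixed F K ℓ).card = Fintype.card F ^ ℓ := by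
  obtain ⟨p, hp⟩ := CharP.exists F
  have : CharP K p := charP_of_injective_algebraMap (algebraMap F K).injective p
  obtain ⟨n, hpp, hn⟩ := FiniteField.card F p
  rw [frobFixed, Multiset.toFinset_card_of_nodup,
    ← (IsAlgClosed.splits _).natDegree_eq_card_roots,
    FiniteField.X_pow_card_pow_sub_X_natDegree_eq K hℓ Fintype.one_lt_card]
  exact Polynomial.nodup_roots (galois_poly_separable p _
    (dvd_pow (hn ▸ dvd_pow_self p n.ne_zero) hℓ))

variable (K)

/-- The exponential sum `∑ χ(N(X - z))` over the degree `ℓ` extension of `F`. -/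
noncomputable def normSum {d : ℕ} (χ : TruncUnits d F →* ℂ) (ℓ : ℕ) : ℂ :=
  ∑ z ∈ frobFixed F K ℓ, χ (polyClass d (normPoly F ℓ z))

end NormPoly

lemma norm_monoidHom_eq_one {G : Type*} [Group G] [Fintype G] (χ : G →* ℂ) (g : G) :
    ‖χ g‖ = 1 :=
  Complex.norm_eq_one_of_pow_eq_one (n := Fintype.card G)
    (by rw [← map_pow, pow_card_eq_one, map_one]) Fintype.card_ne_zero

theorem exists_norm_normSum_two_mul_le (F K : Type*) [Field F] [Fintype F] [Field K] [Algebra F K]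
    [IsAlgClosed K] (k : ℕ) :
    ∃ (C : ℝ) (r₀ : ℕ), ∀ r ≥ r₀, ∀ χ : TruncUnits (k + 1) F →* ℂ, χ ≠ 1 →
      ‖normSum F K χ (2 * r)‖ ≤ C * (Fintype.card F : ℝ) ^ r := by
  obtain ⟨C, r₀, H⟩ := exists_card_linNorm_fibre_le F K k
  refine ⟨C, r₀ + 1, fun r hr χ hχ => ?_⟩
  have hr0 : 2 * r ≠ 0 := by omega
  set q : ℝ := (Fintype.card F : ℝ) with hq
  have hq0 : 0 < q := Nat.cast_pos.2 (Fintype.card_pos (α := F))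
  let T : TruncUnits (k + 1) F → ℕ := fun b =>
    ((frobFixed F K (2 * r)).filter fun z => polyClass (k + 1) (normPoly F (2 * r) z) = b).card
  have hT : ∀ b, (T b : ℝ) ≤ (q ^ (2 * r) + C * q ^ r) / q ^ (k + 1) := fun b => by
    rw [le_div_iff₀ (by positivity)]
    have := H r (by omega) b ((frobFixed F K (2 * r)).filter fun z =>
      polyClass (k + 1) (normPoly F (2 * r) z) = b) fun z hz => by
      rw [Finset.mem_filter, mem_frobFixed F hr0] at hz
      rw [← hz.2, map_polyClass_normPoly F (k + 1) hz.1]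
    rw [hq]
    exact_mod_cast this
  have hsum : ∑ b, (T b : ℝ) = q ^ (2 * r) := by
    have := Finset.card_eq_sum_card_fiberwise (s := frobFixed F K (2 * r)) (t := Finset.univ)
      (f := fun z => polyClass (k + 1) (normPoly F (2 * r) z)) fun _ _ => by simp
    rw [card_frobFixed F hr0] at this
    rw [hq]
    exact_mod_cast this.symm
  have hS : normSum F K χ (2 * r) = ∑ b, (T b : ℂ) * χ b := by
    rw [normSum, ← Finset.sum_fiberwise_of_maps_to (t := Finset.univ)
      (g := fun z => polyClass (k + 1) (normPoly F (2 * r) z)) fun _ _ => by simp]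
    refine Finset.sum_congr rfl fun b _ => ?_
    rw [Finset.sum_congr rfl fun z hz => by rw [(Finset.mem_filter.1 hz).2], Finset.sum_const,
      nsmul_eq_mul]
  set D := (q ^ (2 * r) + C * q ^ r) / q ^ (k + 1) with hD
  have hS' : normSum F K χ (2 * r) = -∑ b, ((D - T b : ℝ) : ℂ) * χ b := by
    simp only [Complex.ofReal_sub, sub_mul, Finset.sum_sub_distrib, ← Finset.mul_sum,
      sum_hom_units_eq_zero χ hχ, hS]
    simp
  rw [hS', norm_neg]
  refine (norm_sum_le _ _).trans ?_
  have h1 : ∀ b, ‖((D - T b : ℝ) : ℂ) * χ b‖ = D - T b := fun b => by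
    rw [norm_mul, norm_monoidHom_eq_one, mul_one, Complex.norm_real, Real.norm_of_nonneg
      (sub_nonneg.2 (hT b))]
  simp only [h1, Finset.sum_sub_distrib, hsum, Finset.sum_const, Finset.card_univ,
    TruncUnits.card_eq, nsmul_eq_mul]
  rw [hD]
  push_cast
  rw [← hq, mul_div_cancel₀ _ (by positivity)]
  linarith

section RootCount

variable (F : Type*) {K : Type*} [Field F] [Fintype F] [Field K] [Algebra F K]

open Polynomial

omit [Field F] [Algebra F K] in
lemma orbitPoly_mul (k e : ℕ) {z : K} (hz : z ^ Fintype.card F ^ e = z) :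
    orbitPoly F (k * e) z = orbitPoly F e z ^ k := by
  have hk : ∀ k, z ^ Fintype.card F ^ (k * e) = z := fun k => by
    induction k with
    | zero => simp
    | succ k ih => rw [add_mul, one_mul, pow_add, pow_mul, ih, hz]
  induction k with
  | zero => simp [orbitPoly]
  | succ k ih =>
    rw [pow_succ, ← ih, add_mul, one_mul]
    simp only [orbitPoly]
    rw [Finset.prod_range_add]
    congr 1
    refine Finset.prod_congr rfl fun i _ => ?_
    rw [pow_add, pow_mul, hk]

lemma minimalPeriod_frob_pos {g : F[X]} (hg : g ≠ 0) {z : K}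
    (hz : z ∈ (g.map (algebraMap F K)).roots) :
    0 < Function.minimalPeriod (fun y : K => y ^ Fintype.card F) z := by
  have hmap : (g.map (algebraMap F K)).map (frobPow F K 1) = g.map (algebraMap F K) := by
    ext i
    simp only [coeff_map, frobPow_algebraMap]
  have hg' : g.map (algebraMap F K) ≠ 0 := map_ne_zero hg
  have hinj : Function.Injective (fun y : K => y ^ Fintype.card F) := fun a b h =>
    (frobPow F K 1).injective (by simpa [frobPow_apply] using h)
  have hroot : ∀ y ∈ (g.map (algebraMap F K)).roots.toFinset,
      y ^ Fintype.card F ∈ (g.map (algebraMap F K)).roots.toFinset := fun y hy => by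
    rw [Multiset.mem_toFinset, mem_roots hg'] at hy ⊢
    have := hy.map (f := frobPow F K 1)
    rwa [hmap, frobPow_apply, pow_one] at this
  have hmem : ∀ i : ℕ, (fun y : K => y ^ Fintype.card F)^[i] z ∈
      (g.map (algebraMap F K)).roots.toFinset := fun i => by
    induction i with
    | zero => simpa using hz
    | succ i ih =>
      rw [Function.iterate_succ_apply']
      exact hroot _ ih
  obtain ⟨i, j, hij, h⟩ := Finite.exists_ne_map_eq_of_infinite
    fun i : ℕ => (⟨_, hmem i⟩ : (g.map (algebraMap F K)).roots.toFinset)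
  rw [Subtype.mk.injEq] at h
  wlog hlt : i < j generalizing i j
  · exact this j i hij.symm h.symm (by omega)
  refine Function.minimalPeriod_pos_of_mem_periodicPts
    (Function.mk_mem_periodicPts (by omega : 0 < j - i) ?_)
  refine (hinj.iterate i) ?_
  rw [← Function.iterate_add_apply, h]
  congr 2
  omega

/-- The multiplicity of a root of `g` counts the degrees `ℓ` for which the norm of `X - z`
divides `g`. -/
lemma card_orbitPoly_dvd {g : F[X]} (hg : g ≠ 0) {r : ℕ} (hr : g.natDegree ≤ r) {z : K}
    (hz : z ∈ (g.map (algebraMap F K)).roots) :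
    ((Finset.Icc 1 r).filter fun ℓ => z ^ Fintype.card F ^ ℓ = z ∧
      orbitPoly F ℓ z ∣ g.map (algebraMap F K)).card =
      (g.map (algebraMap F K)).rootMultiplicity z := by
  set G := g.map (algebraMap F K) with hG
  have hG0 : G ≠ 0 := map_ne_zero hg
  set e := Function.minimalPeriod (fun y : K => y ^ Fintype.card F) z with he
  have he0 : 0 < e := minimalPeriod_frob_pos F hg hz
  have hper : ∀ ℓ, z ^ Fintype.card F ^ ℓ = z ↔ e ∣ ℓ := fun ℓ => by
    rw [he, ← Function.isPeriodicPt_iff_minimalPeriod_dvd, Function.IsPeriodicPt,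
      Function.IsFixedPt, pow_iterate]
  have hdvd : ∀ k, orbitPoly F (k * e) z ∣ G ↔ k ≤ G.rootMultiplicity z := fun k => by
    rw [orbitPoly_mul F k e ((hper e).2 dvd_rfl), le_rootMultiplicity_iff hG0]
    constructor
    · refine fun h => (pow_dvd_pow_of_dvd ?_ k).trans h
      have := Finset.dvd_prod_of_mem (fun i => X - C (z ^ Fintype.card F ^ i))
        (Finset.mem_range.2 he0)
      rwa [pow_zero, pow_one] at this
    · intro h
      rw [orbitPoly, ← Finset.prod_pow]
      refine Finset.prod_dvd_of_coprime (fun i hi j hj hij => ?_) fun i _ => ?_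
      · refine (isCoprime_X_sub_C_of_isUnit_sub (Ne.isUnit (sub_ne_zero.2 fun h => hij ?_))).pow
        refine Function.iterate_injOn_Iio_minimalPeriod (f := fun y : K => y ^ Fintype.card F)
          (x := z) (by simpa using hi) (by simpa using hj) ?_
        simpa only [pow_iterate] using h
      · have h1 := map_dvd (mapRingHom (frobPow F K i)) h
        have h2 : G.map (frobPow F K i) = G := by
          ext i
          simp only [hG, coeff_map, frobPow_algebraMap]
        simpa [h2, frobPow_apply] using h1
  have himg : ((Finset.Icc 1 r).filter fun ℓ => z ^ Fintype.card F ^ ℓ = z ∧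
      orbitPoly F ℓ z ∣ G) = (Finset.Icc 1 (G.rootMultiplicity z)).image (· * e) := by
    ext ℓ
    simp only [Finset.mem_filter, Finset.mem_Icc, Finset.mem_image, hper]
    constructor
    · rintro ⟨⟨h1, -⟩, ⟨k, rfl⟩, h⟩
      rw [mul_comm, hdvd] at h
      exact ⟨k, ⟨Nat.pos_of_ne_zero (by rintro rfl; simp at h1), h⟩, mul_comm _ _⟩
    · rintro ⟨k, ⟨h1, h2⟩, rfl⟩
      refine ⟨⟨Nat.mul_pos h1 he0, ?_⟩, dvd_mul_left _ _, (hdvd k).2 h2⟩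
      have := natDegree_le_of_dvd ((hdvd k).2 h2) hG0
      rw [orbitPoly, natDegree_prod_of_monic _ _ fun _ _ => monic_X_sub_C _] at this
      simp only [natDegree_X_sub_C, Finset.sum_const, Finset.card_range, smul_eq_mul, mul_one,
        hG, natDegree_map] at this
      omega
  rw [himg, Finset.card_image_of_injective _ fun a b h => Nat.eq_of_mul_eq_mul_right he0 h]
  simp

lemma sum_card_normPoly_dvd [IsAlgClosed K] {g : F[X]} (hg : g ≠ 0) {r : ℕ}
    (hr : g.natDegree = r) :
    ∑ ℓ ∈ Finset.Icc 1 r,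
      ((frobFixed F K ℓ).filter fun z => normPoly F ℓ z ∣ g).card = r := by
  set G := g.map (algebraMap F K) with hG
  have hG0 : G ≠ 0 := map_ne_zero hg
  have h1 : ∀ ℓ ∈ Finset.Icc 1 r, ((frobFixed F K ℓ).filter fun z => normPoly F ℓ z ∣ g) =
      Finset.bipartiteAbove (fun ℓ z => z ^ Fintype.card F ^ ℓ = z ∧ orbitPoly F ℓ z ∣ G)
        G.roots.toFinset ℓ := fun ℓ hℓ => by
    ext z
    have hℓ0 : 0 < ℓ := (Finset.mem_Icc.1 hℓ).1
    simp only [Finset.bipartiteAbove, Finset.mem_filter, mem_frobFixed F hℓ0.ne',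
      Multiset.mem_toFinset, mem_roots hG0]
    constructor
    · rintro ⟨hz, h⟩
      rw [← map_dvd_map' (algebraMap F K), map_normPoly F hz] at h
      refine ⟨dvd_iff_isRoot.1 ((Finset.dvd_prod_of_mem _
        (Finset.mem_range.2 hℓ0)).trans h |> fun h => by simpa using h), hz, h⟩
    · rintro ⟨-, hz, h⟩
      refine ⟨hz, ?_⟩
      rwa [← map_dvd_map' (algebraMap F K), map_normPoly F hz]
  rw [Finset.sum_congr rfl fun ℓ hℓ => by rw [h1 ℓ hℓ],
    Finset.sum_card_bipartiteAbove_eq_sum_card_bipartiteBelow]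
  have h2 : ∀ z ∈ G.roots.toFinset, (Finset.bipartiteBelow
      (fun ℓ z => z ^ Fintype.card F ^ ℓ = z ∧ orbitPoly F ℓ z ∣ G) (Finset.Icc 1 r) z).card =
      G.roots.count z := fun z hz => by
    rw [count_roots, ← card_orbitPoly_dvd F hg hr.le (Multiset.mem_toFinset.1 hz)]
    rfl
  rw [Finset.sum_congr rfl h2, Multiset.toFinset_sum_count_eq,
    ← (IsAlgClosed.splits G).natDegree_eq_card_roots, hG, natDegree_map, hr]

end RootCount

section MonicSum

variable {F : Type*} [Field F]

open Polynomial

lemma degree_sum_C_mul_X_pow_lt (n : ℕ) (c : Fin n → F) :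
    (∑ j : Fin n, C (c j) * X ^ (j : ℕ)).degree < (n : WithBot ℕ) := by
  refine (degree_sum_le _ _).trans_lt ((Finset.sup_lt_iff (WithBot.bot_lt_coe n)).2 fun j _ => ?_)
  exact (degree_C_mul_X_pow_le _ _).trans_lt (Nat.cast_lt.2 j.2)

lemma monicOfCoeffs_monic (n : ℕ) (c : Fin n → F) : (monicOfCoeffs n c).Monic :=
  monic_X_pow_add (degree_sum_C_mul_X_pow_lt n c)

lemma natDegree_monicOfCoeffs (n : ℕ) (c : Fin n → F) : (monicOfCoeffs n c).natDegree = n := by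
  rw [monicOfCoeffs, natDegree_add_eq_left_of_degree_lt, natDegree_X_pow]
  simpa using degree_sum_C_mul_X_pow_lt n c

lemma coeff_sum_C_mul_X_pow (n : ℕ) (c : Fin n → F) (i : ℕ) :
    (∑ j : Fin n, C (c j) * X ^ (j : ℕ)).coeff i = if h : i < n then c ⟨i, h⟩ else 0 := by
  rw [finsetSum_coeff]
  simp only [coeff_C_mul, coeff_X_pow, mul_ite, mul_one, mul_zero]
  split_ifs with h
  · rw [Finset.sum_eq_single ⟨i, h⟩] <;> simp +contextual [Fin.ext_iff, eq_comm]
  · exact Finset.sum_eq_zero fun j _ => if_neg (by omega)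

lemma coeff_monicOfCoeffs (n : ℕ) (c : Fin n → F) (i : Fin n) :
    (monicOfCoeffs n c).coeff i = c i := by
  rw [monicOfCoeffs, coeff_add, coeff_sum_C_mul_X_pow, coeff_X_pow, if_neg (by omega),
    dif_pos i.2, zero_add]

lemma monicOfCoeffs_injective (n : ℕ) :
    Function.Injective (monicOfCoeffs n : (Fin n → F) → F[X]) := fun c c' h =>
  funext fun i => by rw [← coeff_monicOfCoeffs n c, h, coeff_monicOfCoeffs]

lemma exists_monicOfCoeffs_eq {g : F[X]} (hg : g.Monic) :
    monicOfCoeffs g.natDegree (fun i => g.coeff i) = g := by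
  conv_rhs => rw [hg.as_sum]
  rw [monicOfCoeffs, Finset.sum_range]

lemma polyClass_monicOfCoeffs {d n : ℕ} (hd : d ≤ n) (c : Fin n → F) (i : Fin d) :
    polyClass d (monicOfCoeffs n c) i = c ⟨n - (i + 1), by omega⟩ := by
  rw [polyClass, TruncUnits.ofSeries, coeff_coe, coeff_reverse, natDegree_monicOfCoeffs,
    revAt_le (by omega)]
  exact coeff_monicOfCoeffs n c ⟨n - (i + 1), by omega⟩

/-- Monic polynomials of degree `n ≥ d` are equidistributed in the classes. -/
lemma sum_polyClass_monicOfCoeffs [Fintype F] {A : Type*} [CommSemiring A] {d n : ℕ} (hd : d ≤ n)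
    (f : TruncUnits d F → A) :
    ∑ c : Fin n → F, f (polyClass d (monicOfCoeffs n c)) =
      (Fintype.card F : A) ^ (n - d) * ∑ b, f b := by
  obtain ⟨s, rfl⟩ := Nat.exists_eq_add_of_le' hd
  rw [← (Fin.appendEquiv s d).sum_comp, Fintype.sum_prod_type]
  have h : ∀ (u : Fin s → F) (v : Fin d → F),
      polyClass d (monicOfCoeffs (s + d) (Fin.appendEquiv s d (u, v))) =
        Equiv.arrowCongr Fin.revPerm (Equiv.refl F) v := fun u v => by
    funext i
    rw [polyClass_monicOfCoeffs (by omega)]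
    have : (⟨s + d - (i + 1), by omega⟩ : Fin (s + d)) = Fin.natAdd s i.rev :=
      Fin.ext (by simp [Fin.val_rev]; omega)
    rw [this]
    exact Fin.append_right u v i.rev
  simp only [h]
  rw [Finset.sum_const, (Equiv.arrowCongr Fin.revPerm (Equiv.refl F)).sum_comp f]
  simp
  rfl

variable [Fintype F]

/-- The monic polynomials of degree `n`. -/
noncomputable def monics (F : Type*) [Field F] [Fintype F] (n : ℕ) : Finset F[X] :=
  Finset.univ.image (monicOfCoeffs n)

lemma mem_monics {n : ℕ} {g : F[X]} : g ∈ monics F n ↔ g.Monic ∧ g.natDegree = n := by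
  simp only [monics, Finset.mem_image, Finset.mem_univ, true_and]
  constructor
  · rintro ⟨c, rfl⟩
    exact ⟨monicOfCoeffs_monic n c, natDegree_monicOfCoeffs n c⟩
  · rintro ⟨hg, rfl⟩
    exact ⟨_, exists_monicOfCoeffs_eq hg⟩

/-- The coefficients of the `L`-function of `χ`. -/
noncomputable def charSum {d : ℕ} (χ : TruncUnits d F →* ℂ) (r : ℕ) : ℂ :=
  ∑ g ∈ monics F r, χ (polyClass d g)

lemma charSum_zero {d : ℕ} (χ : TruncUnits d F →* ℂ) : charSum χ 0 = 1 := by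
  have : monics F 0 = {1} := by
    ext g
    rw [mem_monics, Finset.mem_singleton]
    constructor
    · rintro ⟨h1, h2⟩
      exact h1.natDegree_eq_zero.1 h2
    · rintro rfl
      simp
  simp [charSum, this, polyClass_one]

lemma charSum_eq_zero {d r : ℕ} {χ : TruncUnits d F →* ℂ} (hχ : χ ≠ 1) (hr : d ≤ r) :
    charSum χ r = 0 := by
  rw [charSum, monics, Finset.sum_image fun _ _ _ _ h => monicOfCoeffs_injective r h,
    sum_polyClass_monicOfCoeffs hr, sum_hom_units_eq_zero χ hχ, mul_zero]

variable (K : Type*) [Field K] [Algebra F K]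

lemma normSum_mul_charSum {d : ℕ} (χ : TruncUnits d F →* ℂ) {r ℓ : ℕ} (hℓ : 1 ≤ ℓ) (hr : ℓ ≤ r) :
    normSum F K χ ℓ * charSum χ (r - ℓ) = ∑ g ∈ monics F r,
      ((frobFixed F K ℓ).filter fun z => normPoly F ℓ z ∣ g).card * χ (polyClass d g) := by
  have h : ∀ z ∈ frobFixed F K ℓ, χ (polyClass d (normPoly F ℓ z)) * charSum χ (r - ℓ) =
      ∑ g ∈ (monics F r).filter (normPoly F ℓ z ∣ ·), χ (polyClass d g) := fun z hz => by
    rw [mem_frobFixed F (by omega)] at hz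
    have hm := normPoly_monic F hz
    have hdeg := natDegree_normPoly F hz
    rw [charSum, Finset.mul_sum]
    refine Finset.sum_bij (fun g _ => normPoly F ℓ z * g) (fun g hg => ?_)
      (fun g _ g' _ h => mul_left_cancel₀ hm.ne_zero h) (fun g hg => ?_) fun g hg => ?_
    · rw [mem_monics] at hg
      rw [Finset.mem_filter, mem_monics, hm.natDegree_mul hg.1, hdeg, hg.2]
      exact ⟨⟨hm.mul hg.1, by omega⟩, dvd_mul_right _ _⟩
    · rw [Finset.mem_filter, mem_monics] at hg
      obtain ⟨⟨hg1, hg2⟩, g', rfl⟩ := hg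
      have hg' : g'.Monic := hm.of_mul_monic_left hg1
      rw [hm.natDegree_mul hg', hdeg] at hg2
      exact ⟨g', mem_monics.2 ⟨hg', by omega⟩, rfl⟩
    · rw [polyClass_mul hm (mem_monics.1 hg).1, map_mul]
  rw [normSum, Finset.sum_mul, Finset.sum_congr rfl h]
  simp only [Finset.sum_filter]
  rw [Finset.sum_comm]
  refine Finset.sum_congr rfl fun g _ => ?_
  rw [← Finset.sum_filter, Finset.sum_const, nsmul_eq_mul]

/-- The Newton identities relating the `L`-function of `χ` to its norm sums. -/
theorem mul_charSum_eq_sum [IsAlgClosed K] {d : ℕ} (χ : TruncUnits d F →* ℂ) (r : ℕ) :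
    r * charSum χ r = ∑ ℓ ∈ Finset.Icc 1 r, normSum F K χ ℓ * charSum χ (r - ℓ) := by
  rw [Finset.sum_congr rfl fun ℓ hℓ => normSum_mul_charSum K χ (Finset.mem_Icc.1 hℓ).1
    (Finset.mem_Icc.1 hℓ).2, Finset.sum_comm, charSum, Finset.mul_sum]
  refine Finset.sum_congr rfl fun g hg => ?_
  rw [← Finset.sum_mul]
  congr 1
  rw [mem_monics] at hg
  exact_mod_cast (sum_card_normPoly_dvd (K := K) F hg.1.ne_zero hg.2).symm

end MonicSum

section PowerSums

open Polynomial

lemma exists_fin_map_eq {A : Type*} (s : Multiset A) {d : ℕ} (h : s.card = d) :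
    ∃ f : Fin d → A, Finset.univ.val.map f = s := by
  subst h
  refine ⟨fun i => s.toList.get (i.cast (by simp)), ?_⟩
  have h1 : (Finset.univ : Finset (Fin s.card)).val = ↑(List.finRange s.card) := rfl
  rw [h1, Multiset.map_coe]
  conv_rhs => rw [← s.coe_toList]
  congr 1
  refine List.ext_getElem (by simp) fun i h1 h2 => by simp

/-- A sequence vanishing from `d + 1` on is, up to signs, the sequence of elementary symmetric
functions of `d` numbers. -/
lemma exists_eq_esymm {d : ℕ} {A : ℕ → ℂ} (h0 : A 0 = 1) (hA : ∀ r, d < r → A r = 0) :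
    ∃ α : Fin d → ℂ, ∀ r, A r = (-1) ^ r * (Finset.univ.val.map α).esymm r := by
  let p : ℂ[X] := monicOfCoeffs d fun j => A (d - j)
  have hdeg : p.natDegree = d := natDegree_monicOfCoeffs _ _
  have hmon : p.Monic := monicOfCoeffs_monic _ _
  have hcard : p.roots.card = p.natDegree :=
    (IsAlgClosed.splits p).natDegree_eq_card_roots.symm
  obtain ⟨α, hα⟩ := exists_fin_map_eq p.roots (hcard.trans hdeg)
  refine ⟨α, fun r => ?_⟩
  rw [hα]
  rcases lt_or_ge d r with hr | hr
  · rw [hA r hr, Multiset.esymm, Multiset.powersetCard_eq_empty _ (by omega)]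
    simp
  · have := coeff_eq_esymm_roots_of_card hcard (k := d - r) (by omega)
    rw [hmon.leadingCoeff, one_mul, hdeg, Nat.sub_sub_self hr] at this
    rw [← this]
    rcases Nat.eq_zero_or_pos r with rfl | hr0
    · rw [h0, Nat.sub_zero]
      conv_rhs => rw [← hdeg]
      exact hmon.leadingCoeff.symm
    · have := coeff_monicOfCoeffs d (fun j => A (d - j)) ⟨d - r, by omega⟩
      refine Eq.trans ?_ this.symm
      simp only
      congr 1
      omega

/-- Newton's identities, in multiplicity-free form. -/
lemma mul_esymm_eq_neg_sum {d : ℕ} (α : Fin d → ℂ) (r : ℕ) :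
    (r : ℂ) * ((-1) ^ r * (Finset.univ.val.map α).esymm r) =
      -∑ ℓ ∈ Finset.Icc 1 r, (∑ i, α i ^ ℓ) *
        ((-1) ^ (r - ℓ) * (Finset.univ.val.map α).esymm (r - ℓ)) := by
  have h := congrArg (MvPolynomial.aeval α) (MvPolynomial.mul_esymm_eq_sum (Fin d) ℂ r)
  simp only [map_mul, map_natCast, map_pow, map_neg, map_one, map_sum,
    MvPolynomial.aeval_esymm_eq_multiset_esymm, MvPolynomial.psum, MvPolynomial.aeval_X] at h
  rw [mul_left_comm, h, ← mul_assoc, ← pow_add, show r + (r + 1) = 2 * r + 1 by ring, pow_succ,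
    pow_mul, neg_one_sq, one_pow, one_mul, neg_one_mul]
  congr 1
  refine Finset.sum_bij' (fun a _ => a.2) (fun ℓ _ => (r - ℓ, ℓ)) (fun a ha => ?_) (fun ℓ hℓ => ?_)
    (fun a ha => ?_) (fun _ _ => rfl) fun a ha => ?_
  · rw [Finset.mem_filter, Finset.HasAntidiagonal.mem_antidiagonal] at ha
    rw [Finset.mem_Icc]
    omega
  · rw [Finset.mem_Icc] at hℓ
    rw [Finset.mem_filter, Finset.HasAntidiagonal.mem_antidiagonal]
    simp only
    omega
  · rw [Finset.mem_filter, Finset.HasAntidiagonal.mem_antidiagonal] at ha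
    exact Prod.ext (by simp only; omega) rfl
  · rw [Finset.mem_filter, Finset.HasAntidiagonal.mem_antidiagonal] at ha
    rw [show r - a.2 = a.1 by omega]
    ring

lemma exists_eq_neg_sum_pow {d : ℕ} {A S : ℕ → ℂ} (h0 : A 0 = 1) (hA : ∀ r, d < r → A r = 0)
    (hS : ∀ r : ℕ, r * A r = ∑ ℓ ∈ Finset.Icc 1 r, S ℓ * A (r - ℓ)) :
    ∃ α : Fin d → ℂ, ∀ ℓ, 1 ≤ ℓ → S ℓ = -∑ i, α i ^ ℓ := by
  obtain ⟨α, hα⟩ := exists_eq_esymm h0 hA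
  refine ⟨α, fun ℓ => ?_⟩
  induction ℓ using Nat.strong_induction_on with
  | _ ℓ ih =>
    intro hℓ
    have h1 := mul_esymm_eq_neg_sum α ℓ
    simp only [← hα] at h1
    rw [hS, ← Finset.sum_neg_distrib, ← Finset.Ico_insert_right hℓ,
      Finset.sum_insert (by simp), Finset.sum_insert (by simp), Nat.sub_self, h0, mul_one,
      mul_one, Finset.sum_congr rfl fun t ht => by
        rw [ih t (Finset.mem_Ico.1 ht).2 (Finset.mem_Ico.1 ht).1, neg_mul]] at h1
    exact add_right_cancel h1

lemma norm_le_of_norm_sum_pow_le {d : ℕ} {β : Fin d → ℂ} {C Q : ℝ} (hQ : 0 < Q) {r₀ : ℕ}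
    (h : ∀ r ≥ r₀, ‖∑ i, β i ^ r‖ ≤ C * Q ^ r) (j : Fin d) : ‖β j‖ ≤ Q := by
  by_contra! hj
  let P : ℂ[X] := ∏ b ∈ (Finset.univ.image β).erase (β j), (X - Polynomial.C b)
  have hP0 : ∀ i, β i ≠ β j → P.eval (β i) = 0 := fun i hi => by
    rw [eval_prod]
    exact Finset.prod_eq_zero (i := β i) (by simp [hi]) (by simp)
  have hPj : P.eval (β j) ≠ 0 := by
    rw [eval_prod]
    refine Finset.prod_ne_zero_iff.2 fun b hb => ?_
    simpa [sub_eq_zero] using (Finset.ne_of_mem_erase hb).symm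
  set m := (Finset.univ.filter fun i => β i = β j).card with hm
  have hm0 : (m : ℂ) ≠ 0 := by
    rw [Nat.cast_ne_zero, hm, Finset.card_ne_zero]
    exact ⟨j, by simp⟩
  have key : ∀ k, ∑ t ∈ Finset.range (P.natDegree + 1), P.coeff t * ∑ i, β i ^ (k + t) =
      m * P.eval (β j) * β j ^ k := fun k => by
    have h1 : ∑ t ∈ Finset.range (P.natDegree + 1), P.coeff t * ∑ i, β i ^ (k + t) =
        ∑ i, β i ^ k * P.eval (β i) := by
      simp only [eval_eq_sum_range, Finset.mul_sum]
      rw [Finset.sum_comm]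
      refine Finset.sum_congr rfl fun i _ => Finset.sum_congr rfl fun t _ => ?_
      ring
    rw [h1, ← Finset.sum_filter_add_sum_filter_not _ (fun i => β i = β j),
      Finset.sum_congr rfl fun i hi => by rw [(Finset.mem_filter.1 hi).2],
      Finset.sum_eq_zero (s := Finset.univ.filter fun i => ¬ β i = β j) fun i hi => by
        rw [hP0 i (Finset.mem_filter.1 hi).2, mul_zero],
      Finset.sum_const, nsmul_eq_mul]
    ring
  set D := ∑ t ∈ Finset.range (P.natDegree + 1), ‖P.coeff t‖ * (C * Q ^ t) with hD
  have hbound : ∀ k ≥ r₀, ‖(m : ℂ) * P.eval (β j)‖ * (‖β j‖ / Q) ^ k ≤ D := fun k hk => by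
    rw [div_pow, ← mul_div_assoc, div_le_iff₀ (by positivity), ← norm_pow, ← norm_mul, ← key,
      hD, Finset.sum_mul]
    refine (norm_sum_le _ _).trans (Finset.sum_le_sum fun t _ => ?_)
    rw [norm_mul, mul_assoc]
    refine mul_le_mul_of_nonneg_left ((h _ (by omega)).trans_eq ?_) (norm_nonneg _)
    rw [pow_add]
    ring
  have hlim := (tendsto_pow_atTop_atTop_of_one_lt ((one_lt_div hQ).2 hj)).const_mul_atTop
    (norm_pos_iff.2 (mul_ne_zero hm0 hPj))
  obtain ⟨k, hk1, hk2⟩ := ((hlim.eventually_gt_atTop D).and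
    (Filter.eventually_ge_atTop r₀)).exists
  exact absurd (hbound k hk2) (not_le.2 hk1)

end PowerSums

/-- Weil's bound for the norm sums attached to a nontrivial character. -/
theorem norm_normSum_le (F K : Type*) [Field F] [Fintype F] [Field K] [Algebra F K]
    [IsAlgClosed K] {d : ℕ} (hd : 0 < d) {χ : TruncUnits d F →* ℂ} (hχ : χ ≠ 1) {ℓ : ℕ}
    (hℓ : 1 ≤ ℓ) : ‖normSum F K χ ℓ‖ ≤ d * √(Fintype.card F) ^ ℓ := by
  obtain ⟨k, rfl⟩ := Nat.exists_eq_succ_of_ne_zero hd.ne'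
  obtain ⟨α, hα⟩ := exists_eq_neg_sum_pow (charSum_zero χ) (fun r hr => charSum_eq_zero hχ hr.le)
    (mul_charSum_eq_sum K χ)
  obtain ⟨C, r₀, hC⟩ := exists_norm_normSum_two_mul_le F K k
  have hq : (0 : ℝ) < Fintype.card F := Nat.cast_pos.2 Fintype.card_pos
  have hαle : ∀ i, ‖α i‖ ≤ √(Fintype.card F) := fun i => by
    refine Real.le_sqrt_of_sq_le ?_
    rw [← norm_pow]
    refine norm_le_of_norm_sum_pow_le (β := fun i => α i ^ 2) (C := C) hq (r₀ := r₀ + 1)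
      (fun r hr => ?_) i
    have := hC r (by omega) χ hχ
    rw [hα _ (by omega), norm_neg] at this
    simpa only [← pow_mul] using this
  rw [hα ℓ hℓ, norm_neg]
  refine (norm_sum_le _ _).trans ((Finset.sum_le_sum fun i _ => ?_).trans_eq
    (by rw [Finset.sum_const, Finset.card_univ, Fintype.card_fin, nsmul_eq_mul]))
  rw [norm_pow]
  exact pow_le_pow_left₀ (norm_nonneg _) (hαle i) ℓ

section Cycles

variable {ι : Type*} (σ : Equiv.Perm ι)

/-- The cycles of a permutation, fixed points included. -/
abbrev CycleIndex : Type _ := Quotient (Equiv.Perm.SameCycle.setoid σ)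

variable {σ}

/-- The length of a cycle. -/
noncomputable def cycleLength (o : CycleIndex σ) : ℕ := Function.minimalPeriod σ o.out

variable [Finite ι]

lemma cycleLength_pos (o : CycleIndex σ) : 0 < cycleLength o :=
  Function.minimalPeriod_pos_of_mem_periodicPts
    (σ.injective.mem_periodicPts o.out)

lemma exists_iterate_out_eq (j : ι) :
    ∃ i < cycleLength (σ := σ) (Quotient.mk _ j),
      σ^[i] (Quotient.mk (Equiv.Perm.SameCycle.setoid σ) j).out = j := by
  have h : σ.SameCycle (Quotient.mk (Equiv.Perm.SameCycle.setoid σ) j).out j :=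
    Quotient.exact (s := Equiv.Perm.SameCycle.setoid σ) (Quotient.out_eq _)
  obtain ⟨i, hi⟩ := h.exists_nat_pow_eq
  refine ⟨i % cycleLength _, Nat.mod_lt _ (cycleLength_pos _), ?_⟩
  rw [cycleLength, Function.iterate_mod_minimalPeriod_eq, Equiv.Perm.iterate_eq_pow, hi]

omit [Finite ι] in
lemma mk_iterate_out (o : CycleIndex σ) (i : ℕ) :
    Quotient.mk (Equiv.Perm.SameCycle.setoid σ) (σ^[i] o.out) = o := by
  conv_rhs => rw [← Quotient.out_eq o]
  refine Quotient.sound ?_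
  change σ.SameCycle _ _
  rw [Equiv.Perm.iterate_eq_pow, Equiv.Perm.sameCycle_pow_left]

lemma mod_cycleLength_eq {o : CycleIndex σ} {a b : ℕ} (h : σ^[a] o.out = σ^[b] o.out) :
    a % cycleLength o = b % cycleLength o := by
  refine Function.iterate_injOn_Iio_minimalPeriod (f := σ) (x := o.out)
    (Nat.mod_lt _ (cycleLength_pos o)) (Nat.mod_lt _ (cycleLength_pos o)) ?_
  simpa only [cycleLength, Function.iterate_mod_minimalPeriod_eq] using h

lemma prod_eq_prod_cycleIndex {ι : Type*} [Fintype ι] {σ : Equiv.Perm ι} {A : Type*}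
    [CommMonoid A] (f : ι → A) :
    ∏ j, f j = ∏ o : CycleIndex σ, ∏ i ∈ Finset.range (cycleLength o), f (σ^[i] o.out) := by
  rw [← Finset.prod_fiberwise_of_maps_to (t := Finset.univ)
    (g := Quotient.mk (Equiv.Perm.SameCycle.setoid σ)) (fun _ _ => Finset.mem_univ _)]
  refine Finset.prod_congr rfl fun o _ => ?_
  symm
  refine Finset.prod_nbij (fun i => σ^[i] o.out) (fun i _ => ?_) ?_ (fun j hj => ?_)
    fun _ _ => rfl
  · simp [mk_iterate_out]
  · rw [Finset.coe_range]
    exact Function.iterate_injOn_Iio_minimalPeriod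
  · obtain rfl : _ = o := (Finset.mem_filter.1 hj).2
    obtain ⟨i, hi, hij⟩ := exists_iterate_out_eq (σ := σ) j
    exact ⟨i, by simpa using hi, hij⟩

lemma sum_cycleLength {ι : Type*} [Fintype ι] (σ : Equiv.Perm ι) :
    ∑ o : CycleIndex σ, cycleLength o = Fintype.card ι := by
  have := prod_eq_prod_cycleIndex (σ := σ) (fun _ => Multiplicative.ofAdd 1)
  simpa [← ofAdd_sum, ← ofAdd_nsmul] using (congrArg Multiplicative.toAdd this).symm

end Cycles

section FrobTuples

variable (F K : Type*) [Field F] [Fintype F] [Field K] [Algebra F K]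
  {ι : Type*} [Fintype ι] (σ : Equiv.Perm ι)

/-- The tuples on which Frobenius acts through the permutation `σ`. -/
noncomputable def frobTuples : Finset (ι → K) :=
  (Fintype.piFinset fun _ => frobFixed F K (orderOf σ)).filter
    fun z => ∀ j, z j ^ Fintype.card F = z (σ j)

variable {K σ}

omit [Field F] [Algebra F K] [Fintype ι] in
lemma pow_card_pow_eq_iterate {z : ι → K} (hz : ∀ j, z j ^ Fintype.card F = z (σ j)) (i : ℕ)
    (j : ι) : z j ^ Fintype.card F ^ i = z (σ^[i] j) := by
  induction i with
  | zero => simp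
  | succ i ih => rw [pow_succ, pow_mul, ih, hz, Function.iterate_succ_apply']

omit [Algebra F K] in
lemma mem_frobTuples {z : ι → K} :
    z ∈ frobTuples F K σ ↔ ∀ j, z j ^ Fintype.card F = z (σ j) := by
  rw [frobTuples, Finset.mem_filter, Fintype.mem_piFinset]
  refine ⟨And.right, fun h => ⟨fun j => ?_, h⟩⟩
  rw [mem_frobFixed F (orderOf_pos σ).ne', pow_card_pow_eq_iterate F h,
    Equiv.Perm.iterate_eq_pow, pow_orderOf_eq_one, Equiv.Perm.one_apply]

lemma map_frobPow_prod_X_sub_C {z : ι → K} (hz : ∀ j, z j ^ Fintype.card F = z (σ j)) :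
    (∏ j, (Polynomial.X - Polynomial.C (z j))).map (frobPow F K 1) =
      ∏ j, (Polynomial.X - Polynomial.C (z j)) := by
  rw [Polynomial.map_prod]
  simp only [Polynomial.map_sub, Polynomial.map_X, Polynomial.map_C, frobPow_apply, pow_one, hz]
  exact Equiv.prod_comp σ fun j => Polynomial.X - Polynomial.C (z j)

/-- The polynomial over `F` whose roots form the given Frobenius stable tuple. -/
noncomputable def tuplePoly (z : ι → K) : Polynomial F :=
  if h : (∏ j, (Polynomial.X - Polynomial.C (z j))).map (frobPow F K 1) =
      ∏ j, (Polynomial.X - Polynomial.C (z j)) then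
    (exists_map_eq_of_map_frobPow_eq F h).choose else 1

lemma map_tuplePoly {z : ι → K} (hz : z ∈ frobTuples F K σ) :
    (tuplePoly F z).map (algebraMap F K) = ∏ j, (Polynomial.X - Polynomial.C (z j)) := by
  have h := map_frobPow_prod_X_sub_C F ((mem_frobTuples F).1 hz)
  rw [tuplePoly, dif_pos h]
  exact (exists_map_eq_of_map_frobPow_eq F h).choose_spec

lemma tuplePoly_monic {z : ι → K} (hz : z ∈ frobTuples F K σ) : (tuplePoly F z).Monic := by
  refine Polynomial.monic_of_injective (algebraMap F K).injective ?_
  rw [map_tuplePoly F hz]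
  exact Polynomial.monic_prod_of_monic _ _ fun _ _ => Polynomial.monic_X_sub_C _

lemma natDegree_tuplePoly {z : ι → K} (hz : z ∈ frobTuples F K σ) :
    (tuplePoly F z).natDegree = Fintype.card ι := by
  rw [← Polynomial.natDegree_map (algebraMap F K), map_tuplePoly F hz,
    Polynomial.natDegree_prod_of_monic _ _ fun _ _ => Polynomial.monic_X_sub_C _]
  simp only [Polynomial.natDegree_X_sub_C, Finset.sum_const, Finset.card_univ, smul_eq_mul,
    mul_one]

omit [Algebra F K] in
lemma out_pow_card_pow_cycleLength {z : ι → K} (hz : z ∈ frobTuples F K σ) (o : CycleIndex σ) :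
    z o.out ^ Fintype.card F ^ cycleLength o = z o.out := by
  rw [pow_card_pow_eq_iterate F ((mem_frobTuples F).1 hz), cycleLength,
    Function.iterate_minimalPeriod]

lemma tuplePoly_eq_prod {z : ι → K} (hz : z ∈ frobTuples F K σ) :
    tuplePoly F z = ∏ o : CycleIndex σ, normPoly F (cycleLength o) (z o.out) := by
  refine Polynomial.map_injective _ (algebraMap F K).injective ?_
  rw [map_tuplePoly F hz, Polynomial.map_prod, prod_eq_prod_cycleIndex (σ := σ)]
  refine Finset.prod_congr rfl fun o _ => ?_
  rw [map_normPoly F (out_pow_card_pow_cycleLength F hz o), orbitPoly]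
  refine Finset.prod_congr rfl fun i _ => ?_
  rw [pow_card_pow_eq_iterate F ((mem_frobTuples F).1 hz)]

omit [Algebra F K] in
lemma sum_frobTuples {A : Type*} [CommSemiring A] (f : (o : CycleIndex σ) → K → A) :
    ∑ z ∈ frobTuples F K σ, ∏ o : CycleIndex σ, f o (z o.out) =
      ∏ o : CycleIndex σ, ∑ y ∈ frobFixed F K (cycleLength o), f o y := by
  rw [Finset.prod_univ_sum]
  refine Finset.sum_nbij (fun z o => z o.out) (fun z hz => ?_) (fun z hz w hw h => ?_)
    (fun y hy => ?_) fun _ _ => rfl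
  · rw [Fintype.mem_piFinset]
    intro o
    rw [mem_frobFixed F (cycleLength_pos o).ne']
    exact out_pow_card_pow_cycleLength F hz o
  · rw [Finset.mem_coe, mem_frobTuples] at hz hw
    funext j
    obtain ⟨i, -, hij⟩ := exists_iterate_out_eq (σ := σ) j
    rw [← hij, ← pow_card_pow_eq_iterate F hz, ← pow_card_pow_eq_iterate F hw]
    exact congrArg (· ^ _) (congrFun h _)
  · rw [Finset.mem_coe, Fintype.mem_piFinset] at hy
    have hper : ∀ {o : CycleIndex σ} {a b : ℕ}, σ^[a] o.out = σ^[b] o.out →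
        y o ^ Fintype.card F ^ a = y o ^ Fintype.card F ^ b := fun {o a b} hab => by
      have hp : Function.IsPeriodicPt (fun x : K => x ^ Fintype.card F) (cycleLength o) (y o) := by
        rw [Function.IsPeriodicPt, Function.IsFixedPt, pow_iterate]
        exact (mem_frobFixed F (cycleLength_pos o).ne').1 (hy o)
      have h1 := hp.iterate_mod_apply a
      rw [mod_cycleLength_eq hab, hp.iterate_mod_apply b] at h1
      simpa only [pow_iterate] using h1.symm
    choose idx _ hidx using exists_iterate_out_eq (σ := σ)
    refine ⟨fun j => y (Quotient.mk _ j) ^ Fintype.card F ^ idx j, ?_, ?_⟩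
    · rw [Finset.mem_coe, mem_frobTuples]
      intro j
      have hj : Quotient.mk (Equiv.Perm.SameCycle.setoid σ) (σ j) = Quotient.mk _ j :=
        Quotient.sound (Equiv.Perm.sameCycle_apply_left.2 (Equiv.Perm.SameCycle.refl σ j))
      have h1 := hidx (σ j)
      rw [hj] at h1
      rw [hj, ← pow_mul, ← pow_succ]
      refine hper ?_
      rw [h1, Function.iterate_succ_apply', hidx]
    · funext o
      have h0 := hidx o.out
      simp only [Quotient.out_eq] at h0 ⊢
      simpa using hper (b := 0) h0

lemma card_frobTuples [IsAlgClosed K] :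
    (frobTuples F K σ).card = Fintype.card F ^ Fintype.card ι := by
  have := sum_frobTuples F (K := K) (σ := σ) (A := ℕ) fun _ _ => 1
  simp only [Finset.prod_const_one, Finset.sum_const, smul_eq_mul, mul_one] at this
  rw [this, Finset.prod_congr rfl fun o _ => card_frobFixed F (cycleLength_pos o).ne',
    Finset.prod_pow_eq_pow_sum, sum_cycleLength]

lemma sum_polyClass_tuplePoly {d : ℕ} (χ : TruncUnits d F →* ℂ) :
    ∑ z ∈ frobTuples F K σ, χ (polyClass d (tuplePoly F z)) =
      ∏ o : CycleIndex σ, normSum F K χ (cycleLength o) := by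
  simp only [normSum]
  rw [← sum_frobTuples F fun (o : CycleIndex σ) y => χ (polyClass d (normPoly F (cycleLength o) y))]
  refine Finset.sum_congr rfl fun z hz => ?_
  rw [tuplePoly_eq_prod F hz, polyClass_prod _ _ fun o _ =>
    normPoly_monic F (out_pow_card_pow_cycleLength F hz o), map_prod]

lemma norm_sum_polyClass_tuplePoly_le [IsAlgClosed K] {d : ℕ} (hd : 0 < d)
    {χ : TruncUnits d F →* ℂ} (hχ : χ ≠ 1) :
    ‖∑ z ∈ frobTuples F K σ, χ (polyClass d (tuplePoly F z))‖ ≤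
      d ^ Fintype.card ι * √(Fintype.card F) ^ Fintype.card ι := by
  have hd1 : (1 : ℝ) ≤ d := Nat.one_le_cast.2 hd
  rw [sum_polyClass_tuplePoly, norm_prod]
  refine (Finset.prod_le_prod (fun _ _ => norm_nonneg _) fun o _ =>
    norm_normSum_le F K hd hχ (cycleLength_pos o)).trans ?_
  rw [Finset.prod_mul_distrib, Finset.prod_pow_eq_pow_sum, sum_cycleLength, Finset.prod_const,
    Finset.card_univ]
  exact mul_le_mul_of_nonneg_right (pow_le_pow_right₀ hd1 (Fintype.card_quotient_le _))
    (by positivity)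

end FrobTuples

section Parseval

/-- Parseval's identity for a real function on a finite abelian group. -/
lemma sum_norm_sq_addChar {G : Type*} [AddCommGroup G] [Fintype G] (f : G → ℝ) :
    ∑ ψ : AddChar G ℂ, ‖∑ b, (f b : ℂ) * ψ b‖ ^ 2 = Fintype.card G * ∑ b, f b ^ 2 := by
  have h : ∀ ψ : AddChar G ℂ, ((‖∑ b, (f b : ℂ) * ψ b‖ ^ 2 : ℝ) : ℂ) =
      ∑ b, ∑ b', (f b * f b' : ℂ) * ψ (b - b') := fun ψ => by
    rw [Complex.ofReal_pow, ← Complex.mul_conj', map_sum, Finset.sum_mul_sum]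
    refine Finset.sum_congr rfl fun b _ => Finset.sum_congr rfl fun b' _ => ?_
    rw [map_mul, Complex.conj_ofReal, sub_eq_add_neg, AddChar.map_add_eq_mul,
      AddChar.map_neg_eq_conj]
    ring
  rw [← Complex.ofReal_inj, Complex.ofReal_sum, Finset.sum_congr rfl fun ψ _ => h ψ,
    Finset.sum_comm]
  simp only [Finset.sum_comm (s := (Finset.univ : Finset (AddChar G ℂ))), ← Finset.mul_sum,
    AddChar.sum_apply_eq_ite, sub_eq_zero, mul_ite, mul_zero, Finset.sum_ite_eq,
    Finset.mem_univ, if_true]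
  push_cast
  rw [Finset.mul_sum]
  exact Finset.sum_congr rfl fun b _ => by ring

lemma sum_sq_le_of_norm_sum_le {G : Type*} [CommGroup G] [Fintype G] {f : G → ℝ} {B : ℝ}
    (hf : ∑ b, f b = 0) (hB : 0 ≤ B)
    (h : ∀ χ : G →* ℂ, χ ≠ 1 → ‖∑ b, (f b : ℂ) * χ b‖ ^ 2 ≤ B) : ∑ b, f b ^ 2 ≤ B := by
  have hle : ∀ ψ : AddChar (Additive G) ℂ,
      ‖∑ b : Additive G, (f b.toMul : ℂ) * ψ b‖ ^ 2 ≤ B := fun ψ => by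
    let χ : G →* ℂ :=
      { toFun g := ψ (Additive.ofMul g)
        map_one' := ψ.map_zero_eq_one
        map_mul' x y := ψ.map_add_eq_mul _ _ }
    by_cases hχ : χ = 1
    · have h1 : ∀ b, ψ b = 1 := fun b => DFunLike.congr_fun hχ b.toMul
      have h2 : ∑ b : Additive G, f b.toMul = 0 :=
        (Equiv.sum_comp Additive.toMul f).trans hf
      simp only [h1, mul_one, ← Complex.ofReal_sum, h2]
      simpa using hB
    · have := h χ hχ
      rwa [← Equiv.sum_comp Additive.toMul fun b => (f b : ℂ) * χ b] at this
  have hP := sum_norm_sq_addChar fun b : Additive G => f b.toMul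
  have hcard : (0 : ℝ) < Fintype.card (Additive G) := Nat.cast_pos.2 Fintype.card_pos
  have h1 := Finset.sum_le_card_nsmul Finset.univ _ B
    fun (ψ : AddChar (Additive G) ℂ) _ => hle ψ
  rw [hP, Finset.card_univ, nsmul_eq_mul, AddChar.card_eq] at h1
  rw [← Equiv.sum_comp Additive.toMul fun b => f b ^ 2]
  exact le_of_mul_le_mul_left h1 hcard

end Parseval

section ClassCount

variable (F K : Type*) [Field F] [Fintype F] [Field K] [Algebra F K]
  {ι : Type*} [Fintype ι] (σ : Equiv.Perm ι)

/-- The number of tuples permuted by Frobenius through `σ` whose polynomial has class `b`. -/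
noncomputable def classCount {d : ℕ} (b : TruncUnits d F) : ℕ :=
  ((frobTuples F K σ).filter fun z => polyClass d (tuplePoly F z) = b).card

variable [IsAlgClosed K]

lemma sum_classCount (d : ℕ) :
    ∑ b : TruncUnits d F, classCount F K σ b = Fintype.card F ^ Fintype.card ι := by
  rw [← card_frobTuples F (K := K) (σ := σ)]
  exact (Finset.card_eq_sum_card_fiberwise fun _ _ => Finset.mem_coe.2 (Finset.mem_univ _)).symm

lemma sum_classCount_sub_eq_zero {d : ℕ} (hd : d ≤ Fintype.card ι) :
    ∑ b : TruncUnits d F,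
      ((classCount F K σ b : ℝ) - (Fintype.card F : ℝ) ^ (Fintype.card ι - d)) = 0 := by
  rw [Finset.sum_sub_distrib, ← Nat.cast_sum, sum_classCount, Finset.sum_const, Finset.card_univ,
    TruncUnits.card_eq, nsmul_eq_mul, Nat.cast_pow, Nat.cast_pow, ← pow_add,
    Nat.add_sub_cancel' hd, sub_self]

lemma sum_classCount_sub_sq_le {d : ℕ} (hd0 : 0 < d) (hd : d ≤ Fintype.card ι) :
    ∑ b : TruncUnits d F,
      ((classCount F K σ b : ℝ) - (Fintype.card F : ℝ) ^ (Fintype.card ι - d)) ^ 2 ≤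
      (d : ℝ) ^ (2 * Fintype.card ι) * (Fintype.card F : ℝ) ^ Fintype.card ι := by
  refine sum_sq_le_of_norm_sum_le (sum_classCount_sub_eq_zero F K σ hd) (by positivity)
    fun χ hχ => ?_
  have h1 : ∑ b : TruncUnits d F, (((classCount F K σ b : ℝ) -
      (Fintype.card F : ℝ) ^ (Fintype.card ι - d) : ℝ) : ℂ) * χ b =
      ∑ z ∈ frobTuples F K σ, χ (polyClass d (tuplePoly F z)) := by
    simp only [Complex.ofReal_sub, sub_mul, Finset.sum_sub_distrib, ← Finset.mul_sum,
      sum_hom_units_eq_zero χ hχ, mul_zero, sub_zero]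
    rw [← Finset.sum_fiberwise (frobTuples F K σ) fun z => polyClass d (tuplePoly F z)]
    refine Finset.sum_congr rfl fun b _ => ?_
    rw [Finset.sum_congr rfl fun z hz => by rw [(Finset.mem_filter.1 hz).2], Finset.sum_const,
      nsmul_eq_mul, classCount]
    norm_cast
  rw [h1]
  refine (pow_le_pow_left₀ (norm_nonneg _) (norm_sum_polyClass_tuplePoly_le F hd0 hχ) 2).trans_eq
    ?_
  rw [mul_pow, ← pow_mul, ← pow_mul, mul_comm (Fintype.card ι) 2, pow_mul √_,
    Real.sq_sqrt (Nat.cast_nonneg _)]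

end ClassCount

section ShortIntervals

variable {F : Type*} [Field F] [Fintype F] {n : ℕ}

lemma vonMangoldtType_eq_sum (c : Equiv.Perm (Fin n) → ℝ) (f : Polynomial F) :
    vonMangoldtType F n c f = ∑ σ, c σ *
      ((frobTuples F (AlgebraicClosure F) σ).filter fun z => tuplePoly F z = f).card := by
  set s := Finset.univ.biUnion (frobTuples F (AlgebraicClosure F) (ι := Fin n)) with hs
  rw [vonMangoldtType, finsum_eq_sum_of_support_subset (s := s) _ fun z hz => ?_]
  · simp only [← Finset.sum_filter]
    rw [Finset.sum_comm]
    refine Finset.sum_congr rfl fun σ _ => ?_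
    rw [← Finset.mul_sum, Finset.sum_boole, Finset.filter_filter]
    congr 3
    ext z
    simp only [hs, Finset.mem_filter, Finset.mem_biUnion, Finset.mem_univ, true_and]
    constructor
    · rintro ⟨-, h1, h2⟩
      have hz := (mem_frobTuples F).2 h2
      exact ⟨hz, Polynomial.map_injective _ (algebraMap F (AlgebraicClosure F)).injective
        (by rw [map_tuplePoly F hz, h1])⟩
    · rintro ⟨hz, rfl⟩
      exact ⟨⟨σ, hz⟩, map_tuplePoly F hz, (mem_frobTuples F).1 hz⟩
  · rw [Function.mem_support] at hz
    obtain ⟨σ, -, hσ⟩ := Finset.exists_ne_zero_of_sum_ne_zero (ite_ne_right_iff.1 hz).2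
    rw [hs, Finset.mem_coe, Finset.mem_biUnion]
    refine ⟨σ, Finset.mem_univ _, (mem_frobTuples F).2 ?_⟩
    by_contra h
    exact hσ (by rw [if_neg h, mul_zero])

omit [Fintype F] in
lemma monicOfCoeffs_add_sum {k : ℕ} (hk : k ≤ n) (co : Fin n → F) (a : Fin k → F) :
    monicOfCoeffs n co + ∑ j : Fin k, Polynomial.C (a j) * Polynomial.X ^ (j : ℕ) =
      monicOfCoeffs n fun i => co i + if h : (i : ℕ) < k then a ⟨i, h⟩ else 0 := by
  rw [monicOfCoeffs, monicOfCoeffs, add_assoc, add_right_inj]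
  ext i
  rw [Polynomial.coeff_add, coeff_sum_C_mul_X_pow, coeff_sum_C_mul_X_pow, coeff_sum_C_mul_X_pow]
  by_cases h1 : i < n
  · simp [h1]
  · simp [h1, show ¬ i < k by omega]

omit [Fintype F] in
/-- A monic polynomial of degree `n` lies in the short interval around another one exactly when
their classes agree. -/
lemma eq_monicOfCoeffs_add_sum_iff {k d : ℕ} (hkd : d + k = n) (co : Fin n → F)
    {P : Polynomial F} (hP : P.Monic) (hPn : P.natDegree = n) (a : Fin k → F) :
    P = monicOfCoeffs n co + ∑ j : Fin k, Polynomial.C (a j) * Polynomial.X ^ (j : ℕ) ↔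
      polyClass d P = polyClass d (monicOfCoeffs n co) ∧
        (fun j : Fin k => P.coeff j - (monicOfCoeffs n co).coeff j) = a := by
  obtain ⟨p, rfl⟩ : ∃ p, monicOfCoeffs n p = P := by
    subst hPn
    exact ⟨_, exists_monicOfCoeffs_eq hP⟩
  have hd : d ≤ n := by omega
  have hcls : polyClass d (monicOfCoeffs n p) = polyClass d (monicOfCoeffs n co) ↔
      ∀ i : Fin d, p ⟨n - (i + 1), by omega⟩ = co ⟨n - (i + 1), by omega⟩ := by
    refine funext_iff.trans (forall_congr' fun i => ?_)
    rw [polyClass_monicOfCoeffs hd, polyClass_monicOfCoeffs hd]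
  rw [monicOfCoeffs_add_sum (by omega), (monicOfCoeffs_injective n).eq_iff, hcls,
    funext_iff, funext_iff]
  have hco : ∀ (c : Fin n → F) (j : Fin k),
      (monicOfCoeffs n c).coeff j = c ⟨j, by omega⟩ := fun c j =>
    coeff_monicOfCoeffs n c ⟨j, by omega⟩
  simp only [hco]
  constructor
  · refine fun h => ⟨fun i => ?_, fun j => ?_⟩
    · rw [h, dif_neg (by simp; omega), add_zero]
    · rw [h, dif_pos (by simp), add_sub_cancel_left]
  · rintro ⟨h1, h2⟩ i
    by_cases hi : (i : ℕ) < k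
    · rw [dif_pos hi, ← h2 ⟨i, hi⟩, add_sub_cancel]
    · rw [dif_neg hi, add_zero]
      have := h1 ⟨n - (i + 1), by omega⟩
      convert this using 2 <;> (ext; simp; omega)

lemma sum_vonMangoldtType {k d : ℕ} (hkd : d + k = n) (c : Equiv.Perm (Fin n) → ℝ)
    (co : Fin n → F) :
    ∑ a : Fin k → F, vonMangoldtType F n c (monicOfCoeffs n co +
        ∑ j : Fin k, Polynomial.C (a j) * Polynomial.X ^ (j : ℕ)) =
      ∑ σ, c σ * classCount F (AlgebraicClosure F) σ (polyClass d (monicOfCoeffs n co)) := by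
  simp only [vonMangoldtType_eq_sum]
  rw [Finset.sum_comm]
  refine Finset.sum_congr rfl fun σ _ => ?_
  rw [← Finset.mul_sum, ← Nat.cast_sum, classCount, Finset.card_eq_sum_card_fiberwise
    (t := Finset.univ) (f := fun z (j : Fin k) =>
      (tuplePoly F z).coeff j - (monicOfCoeffs n co).coeff j) fun _ _ => by simp]
  congr 2
  refine Finset.sum_congr rfl fun a _ => ?_
  rw [Finset.filter_filter]
  refine congrArg _ (Finset.filter_congr fun z hz => ?_)
  exact eq_monicOfCoeffs_add_sum_iff hkd co (tuplePoly_monic F hz)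
    ((natDegree_tuplePoly F hz).trans (Fintype.card_fin n)) a

lemma classCount_le {K : Type*} [Field K] [Algebra F K] (σ : Equiv.Perm (Fin n)) {d : ℕ}
    (hd : d ≤ n) (b : TruncUnits d F) :
    classCount F K σ b ≤ n ^ n * Fintype.card F ^ (n - d) := by
  set s := (Finset.univ.filter fun c : Fin n → F => polyClass d (monicOfCoeffs n c) = b).image
    (monicOfCoeffs n) with hs
  have hcard : s.card = Fintype.card F ^ (n - d) := by
    have := sum_polyClass_monicOfCoeffs (F := F) hd fun b' => if b' = b then (1 : ℕ) else 0
    rw [hs, Finset.card_image_of_injective _ (monicOfCoeffs_injective n), Finset.card_filter, this]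
    simp
  rw [classCount, ← hcard]
  refine Finset.card_le_mul_card_image_of_maps_to (f := tuplePoly F) (fun z hz => ?_) _
    fun f hf => ?_
  · obtain ⟨hz, hb⟩ := Finset.mem_filter.1 hz
    have h1 := exists_monicOfCoeffs_eq (tuplePoly_monic F hz)
    rw [natDegree_tuplePoly F hz, Fintype.card_fin] at h1
    rw [hs, Finset.mem_image]
    exact ⟨_, by rw [Finset.mem_filter, h1]; exact ⟨Finset.mem_univ _, hb⟩, h1⟩
  · obtain ⟨c, -, rfl⟩ := Finset.mem_image.1 hf
    refine (Finset.card_le_card (t := Fintype.piFinset fun _ : Fin n =>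
      ((monicOfCoeffs n c).map (algebraMap F K)).roots.toFinset) fun z hz => ?_).trans ?_
    · obtain ⟨hz, hzc⟩ := Finset.mem_filter.1 hz
      have hz := (Finset.mem_filter.1 hz).1
      rw [Fintype.mem_piFinset]
      intro j
      rw [Multiset.mem_toFinset, ← hzc, map_tuplePoly F hz, Polynomial.mem_roots
        (Polynomial.monic_prod_of_monic _ _ fun _ _ => Polynomial.monic_X_sub_C _).ne_zero,
        Polynomial.IsRoot, Polynomial.eval_prod]
      exact Finset.prod_eq_zero (Finset.mem_univ j) (by simp)
    · rw [Fintype.card_piFinset_const]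
      refine Nat.pow_le_pow_left ((Multiset.toFinset_card_le _).trans
        ((Polynomial.card_roots' _).trans ?_)) n
      rw [Polynomial.natDegree_map, natDegree_monicOfCoeffs]

end ShortIntervals

/-- A product is its linearization up to a quadratic error. -/
lemma exists_abs_prod_add_sub_le {ι : Type*} (s : Finset ι) (u : ι → ℝ) {A : ℝ} (hA : 0 ≤ A) :
    ∃ C : ℝ, 0 ≤ C ∧ ∃ l : ι → ℝ, ∀ v : ι → ℝ, (∀ i, |v i| ≤ A) →
      |∏ i ∈ s, (u i + v i) - ∏ i ∈ s, u i - ∑ i ∈ s, l i * v i| ≤ C * ∑ i ∈ s, v i ^ 2 := by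
  induction s using Finset.induction_on with
  | empty => exact ⟨0, le_rfl, 0, fun v _ => by simp⟩
  | insert j s hj ih =>
    obtain ⟨C, hC, l, hl⟩ := ih
    have hl0 : 0 ≤ ∑ i ∈ s, l i ^ 2 := Finset.sum_nonneg fun i _ => sq_nonneg _
    refine ⟨1 + ∑ i ∈ s, l i ^ 2 + (|u j| + A) * C, by positivity,
      fun i => if i = j then ∏ i ∈ s, u i else u j * l i, fun v hv => ?_⟩
    have hsum : ∑ i ∈ s, (if i = j then ∏ i ∈ s, u i else u j * l i) * v i =
        u j * ∑ i ∈ s, l i * v i := by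
      rw [Finset.mul_sum]
      refine Finset.sum_congr rfl fun i hi => ?_
      rw [if_neg (ne_of_mem_of_not_mem hi hj), mul_assoc]
    rw [Finset.prod_insert hj, Finset.prod_insert hj, Finset.sum_insert hj,
      Finset.sum_insert hj, hsum]
    simp only [if_true]
    have hE := hl v hv
    set P := ∏ i ∈ s, (u i + v i)
    set P0 := ∏ i ∈ s, u i
    set L := ∑ i ∈ s, l i * v i with hL
    set V := ∑ i ∈ s, v i ^ 2 with hV
    set S := ∑ i ∈ s, l i ^ 2
    have hV0 : 0 ≤ V := Finset.sum_nonneg fun i _ => sq_nonneg _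
    have hLV : L ^ 2 ≤ S * V := Finset.sum_mul_sq_le_sq_mul_sq s l v
    have h1 : |v j * L| ≤ v j ^ 2 + S * V := by
      rw [abs_le]
      constructor <;> nlinarith [sq_nonneg (v j + L), sq_nonneg (v j - L)]
    have h2 : |(u j + v j) * (P - P0 - L)| ≤ (|u j| + A) * (C * V) := by
      rw [abs_mul]
      exact mul_le_mul ((abs_add_le _ _).trans (add_le_add_right (hv j) _)) hE (abs_nonneg _)
        (by positivity)
    have h3 : (u j + v j) * P - u j * P0 - (P0 * v j + u j * L) =
        v j * L + (u j + v j) * (P - P0 - L) := by ring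
    rw [h3]
    refine (abs_add_le _ _).trans ((add_le_add h1 h2).trans ?_)
    have h4 : 0 ≤ (S + (|u j| + A) * C) * v j ^ 2 := by positivity
    nlinarith

section Moments

variable (F K : Type*) [Field F] [Fintype F] [Field K] [Algebra F K] {n : ℕ}

/-- The normalized deviation of a combination of class counts from its average. -/
noncomputable def classDeviation (c : Equiv.Perm (Fin n) → ℝ) {d : ℕ} (b : TruncUnits d F) : ℝ :=
  (∑ σ, c σ * (classCount F K σ b - (Fintype.card F : ℝ) ^ (n - d))) /
    (Fintype.card F : ℝ) ^ (n - d)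

variable {d : ℕ} (c : Equiv.Perm (Fin n) → ℝ)

lemma sum_mul_classCount (b : TruncUnits d F) :
    ∑ σ, c σ * classCount F K σ b =
      (Fintype.card F : ℝ) ^ (n - d) * (∑ σ, c σ + classDeviation F K c b) := by
  have hq : (Fintype.card F : ℝ) ^ (n - d) ≠ 0 := by simp
  rw [classDeviation, mul_add, mul_div_cancel₀ _ hq]
  simp only [mul_sub, Finset.sum_sub_distrib, ← Finset.sum_mul]
  ring

lemma abs_classDeviation_le (hd : d ≤ n) (b : TruncUnits d F) :
    |classDeviation F K c b| ≤ (∑ σ, |c σ|) * (n ^ n + 1) := by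
  have hq : 0 < (Fintype.card F : ℝ) ^ (n - d) := by
    have : (0 : ℝ) < Fintype.card F := Nat.cast_pos.2 Fintype.card_pos
    positivity
  rw [classDeviation, abs_div, abs_of_pos hq, div_le_iff₀ hq, Finset.sum_mul, Finset.sum_mul]
  refine (Finset.abs_sum_le_sum_abs _ _).trans (Finset.sum_le_sum fun σ _ => ?_)
  rw [abs_mul, mul_assoc]
  refine mul_le_mul_of_nonneg_left ?_ (abs_nonneg _)
  have h1 : (classCount F K σ b : ℝ) ≤ n ^ n * (Fintype.card F : ℝ) ^ (n - d) := by
    exact_mod_cast classCount_le σ hd b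
  have h2 : (0 : ℝ) ≤ classCount F K σ b := Nat.cast_nonneg _
  have h3 : (0 : ℝ) ≤ (n : ℝ) ^ n := by positivity
  rw [abs_le]
  constructor <;> nlinarith

variable [IsAlgClosed K]

lemma sum_classDeviation (hd : d ≤ n) : ∑ b : TruncUnits d F, classDeviation F K c b = 0 := by
  simp only [classDeviation]
  rw [← Finset.sum_div, Finset.sum_comm, Finset.sum_eq_zero, zero_div]
  intro σ _
  have := sum_classCount_sub_eq_zero F K σ (d := d) (by simpa using hd)
  rw [Fintype.card_fin] at this
  rw [← Finset.mul_sum, this, mul_zero]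

lemma sum_classDeviation_sq_le (hd0 : 0 < d) (hd : d ≤ n) :
    ∑ b : TruncUnits d F, classDeviation F K c b ^ 2 ≤
      (∑ σ, c σ ^ 2) * (n.factorial * (d : ℝ) ^ (2 * n)) *
        ((Fintype.card F : ℝ) ^ n / ((Fintype.card F : ℝ) ^ (n - d)) ^ 2) := by
  simp only [classDeviation, div_pow]
  rw [← Finset.sum_div, ← mul_div_assoc]
  refine div_le_div_of_nonneg_right ?_ (by positivity)
  refine (Finset.sum_le_sum fun b _ => Finset.sum_mul_sq_le_sq_mul_sq _ _ _).trans ?_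
  rw [← Finset.mul_sum, Finset.sum_comm, mul_assoc]
  refine mul_le_mul_of_nonneg_left ?_ (Finset.sum_nonneg fun _ _ => sq_nonneg _)
  refine (Finset.sum_le_card_nsmul _ _ ((d : ℝ) ^ (2 * n) * (Fintype.card F : ℝ) ^ n)
    fun σ _ => ?_).trans_eq ?_
  · simpa only [Fintype.card_fin] using
      sum_classCount_sub_sq_le F K σ hd0 (by simpa using hd)
  · rw [Finset.card_univ, Fintype.card_perm, Fintype.card_fin, nsmul_eq_mul, mul_assoc]

end Moments

/-- Fix `m ≥ 2`, `n ≥ 4`, `1 ≤ h ≤ n - 3` and real coefficients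
`c i σ`. There is a `C > 0` such that for every finite field `F` with `q` elements (of
characteristic `> n` when `m > 2`), letting `φ i` be the arithmetic function of von Mangoldt
type associated to `(c i σ)σ`,
`|q⁻ⁿ ∑_{f ∈ M_n(F)} ∏ i (∑_{deg g ≤ h} φ i (f + g)) - (∏ i ∑ σ, c i σ) q^{(h+1)m}|
  ≤ C q^{(h+1)(m-1)}`. -/
theorem moments_vonMangoldtType (m n h : ℕ) (hm : 2 ≤ m) (hn : 4 ≤ n) (hh1 : 1 ≤ h)
    (hh2 : h ≤ n - 3) (c : Fin m → Equiv.Perm (Fin n) → ℝ) :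
    ∃ C : ℝ, 0 < C ∧ ∀ (F : Type) [Field F] [Fintype F], (2 < m → n < ringChar F) →
      |(1 / (Fintype.card F : ℝ) ^ n) *
          (∑ co : Fin n → F, ∏ i : Fin m, ∑ a : Fin (h + 1) → F,
            vonMangoldtType F n (c i) (monicOfCoeffs n co +
              ∑ j : Fin (h + 1), Polynomial.C (a j) * Polynomial.X ^ (j : ℕ))) -
        (∏ i : Fin m, ∑ σ : Equiv.Perm (Fin n), c i σ) *
          (Fintype.card F : ℝ) ^ ((h + 1) * m)| ≤
      C * (Fintype.card F : ℝ) ^ ((h + 1) * (m - 1)) := by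
  obtain ⟨d, hd⟩ : ∃ d, d + (h + 1) = n := ⟨n - (h + 1), by omega⟩
  have hd0 : 0 < d := by omega
  have hdn : d ≤ n := by omega
  set A : ℝ := ∑ i, (∑ σ, |c i σ|) * (n ^ n + 1) with hA
  have hA0 : ∀ i, 0 ≤ (∑ σ, |c i σ|) * ((n : ℝ) ^ n + 1) := fun i =>
    mul_nonneg (Finset.sum_nonneg fun _ _ => abs_nonneg _) (by positivity)
  obtain ⟨C, hC, l, hl⟩ := exists_abs_prod_add_sub_le Finset.univ (fun i => ∑ σ, c i σ)
    (Finset.sum_nonneg fun i _ => hA0 i : 0 ≤ A)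
  set B : ℝ := ∑ i, (∑ σ, c i σ ^ 2) * (n.factorial * (d : ℝ) ^ (2 * n)) with hB
  have hB0 : 0 ≤ B := Finset.sum_nonneg fun i _ =>
    mul_nonneg (Finset.sum_nonneg fun _ _ => sq_nonneg _) (by positivity)
  refine ⟨C * B + 1, by positivity, fun F _ _ _ => ?_⟩
  have hq : (0 : ℝ) < Fintype.card F := Nat.cast_pos.2 Fintype.card_pos
  have hnd : n - d = h + 1 := by omega
  set K := AlgebraicClosure F
  set q : ℝ := (Fintype.card F : ℝ) with hqdef
  have hqn : q ^ n = q ^ d * q ^ (h + 1) := by rw [← pow_add, hd]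
  let v : TruncUnits d F → Fin m → ℝ := fun b i => classDeviation F K (c i) b
  have hmain : (1 / q ^ n) * (∑ co : Fin n → F, ∏ i : Fin m, ∑ a : Fin (h + 1) → F,
      vonMangoldtType F n (c i) (monicOfCoeffs n co +
        ∑ j : Fin (h + 1), Polynomial.C (a j) * Polynomial.X ^ (j : ℕ))) =
      q ^ ((h + 1) * m) * (q ^ d)⁻¹ * ∑ b, ∏ i, (∑ σ, c i σ + v b i) := by
    simp only [sum_vonMangoldtType hd, sum_mul_classCount, hnd, Finset.prod_mul_distrib,
      Finset.prod_const, Finset.card_univ, Fintype.card_fin, ← Finset.mul_sum]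
    rw [sum_polyClass_monicOfCoeffs hdn fun b =>
      ∏ i, (∑ σ, c i σ + classDeviation F (AlgebraicClosure F) (c i) b), hnd, ← hqdef, hqn,
      ← pow_mul]
    field_simp
    rfl
  have hsum : |∑ b, ∏ i, (∑ σ, c i σ + v b i) - q ^ d * ∏ i, ∑ σ, c i σ| ≤
      C * (B * (q ^ n / (q ^ (h + 1)) ^ 2)) := by
    have h0 : ∑ b, ∑ i, l i * v b i = 0 := by
      rw [Finset.sum_comm]
      refine Finset.sum_eq_zero fun i _ => ?_
      rw [← Finset.mul_sum, sum_classDeviation F K (c i) hdn, mul_zero]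
    have h1 : ∑ b, ∏ i, (∑ σ, c i σ + v b i) - q ^ d * ∏ i, ∑ σ, c i σ =
        ∑ b : TruncUnits d F, (∏ i, (∑ σ, c i σ + v b i) - ∏ i, ∑ σ, c i σ -
          ∑ i, l i * v b i) := by
      rw [Finset.sum_sub_distrib, Finset.sum_sub_distrib, h0, Finset.sum_const,
        Finset.card_univ, TruncUnits.card_eq, nsmul_eq_mul, Nat.cast_pow, sub_zero]
    rw [h1]
    refine (Finset.abs_sum_le_sum_abs _ _).trans ((Finset.sum_le_sum fun b _ =>
      hl (v b) fun i => ?_).trans ?_)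
    · exact (abs_classDeviation_le F K (c i) hdn b).trans
        (Finset.single_le_sum (fun i _ => hA0 i) (Finset.mem_univ i))
    · rw [← Finset.mul_sum, Finset.sum_comm]
      refine mul_le_mul_of_nonneg_left ?_ hC
      rw [hB, Finset.sum_mul]
      refine Finset.sum_le_sum fun i _ => ?_
      have := sum_classDeviation_sq_le F K (c i) hd0 hdn
      rwa [hnd] at this
  have hfac : q ^ ((h + 1) * m) * (q ^ d)⁻¹ * (q ^ n / (q ^ (h + 1)) ^ 2) =
      q ^ ((h + 1) * (m - 1)) := by
    obtain ⟨m, rfl⟩ : ∃ k, m = k + 1 := ⟨m - 1, by omega⟩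
    rw [Nat.add_sub_cancel, hqn, mul_add, pow_add, mul_one]
    field_simp
  have hpos : 0 < q ^ ((h + 1) * m) * (q ^ d)⁻¹ := by positivity
  calc _ = q ^ ((h + 1) * m) * (q ^ d)⁻¹ *
        |∑ b, ∏ i, (∑ σ, c i σ + v b i) - q ^ d * ∏ i, ∑ σ, c i σ| := by
        rw [hmain, ← abs_of_pos hpos, ← abs_mul, abs_of_pos hpos, mul_sub]
        congr 2
        field_simp
    _ ≤ q ^ ((h + 1) * m) * (q ^ d)⁻¹ * (C * (B * (q ^ n / (q ^ (h + 1)) ^ 2))) :=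
        mul_le_mul_of_nonneg_left hsum hpos.le
    _ = C * B * q ^ ((h + 1) * (m - 1)) := by
        rw [← hfac]
        ring
    _ ≤ (C * B + 1) * q ^ ((h + 1) * (m - 1)) :=
        mul_le_mul_of_nonneg_right (by linarith) (by positivity)
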